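/- arXiv:math/0612409 — 6 statements merged into one kernel-verified Lean document; each statement's English description precedes it below -/
import Mathlib

section
/- For every integer g ≥ 2 one has μ_g ≤ √(2g−1)/g; in particular μ_2 ≤ √3/2. -/
open scoped Real

noncomputable section

/-- The surface relator `∏_{j=1}^g a_j b_j a_j⁻¹ b_j⁻¹` in the free group on the
`2g` generators `a_1, b_1, …, a_g, b_g`, where `(j, false)` stands for `a_j` and
`(j, true)` stands for `b_j`. -/
def surfaceRel (g : ℕ) : FreeGroup (Fin g × Bool) :=
  ((List.finRange g).map fun j =>
    FreeGroup.of (j, false) * FreeGroup.of (j, true) *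
      (FreeGroup.of (j, false))⁻¹ * (FreeGroup.of (j, true))⁻¹).prod

/-- The fundamental group `Γ_g` of the closed orientable surface of genus `g`:
the quotient of the free group on `a_1, b_1, …, a_g, b_g` by the normal closure
of `∏_{j=1}^g a_j b_j a_j⁻¹ b_j⁻¹`. -/
abbrev SurfaceGroup (g : ℕ) :=
  PresentedGroup ({surfaceRel g} : Set (FreeGroup (Fin g × Bool)))

/-- Enumeration of the `4g` elements `a_j, a_j⁻¹, b_j, b_j⁻¹` of `S_g`:
`(j, w, i)` is `a_j` (if `w = false`) or `b_j` (if `w = true`), inverted when `i = true`. -/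
def sgenFun (g : ℕ) (p : Fin g × Bool × Bool) : SurfaceGroup g :=
  if p.2.2 then (PresentedGroup.of (p.1, p.2.1))⁻¹ else PresentedGroup.of (p.1, p.2.1)

open scoped Classical in
/-- The symmetric generating set `S_g = {a_1^{±1}, b_1^{±1}, …, a_g^{±1}, b_g^{±1}}`
of `Γ_g`. -/
def Sgen (g : ℕ) : Finset (SurfaceGroup g) :=
  Finset.image (sgenFun g) Finset.univ

/-- `M` is the Markov operator of the simple random walk on `(Γ_g, S_g)`, i.e. the
bounded operator on `ℓ²(Γ_g)` given by `(M f)(x) = (1/(4g)) ∑_{s ∈ S_g} f(xs)`;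
`μ_g` is by definition its operator norm `‖M‖`. -/
def IsMarkov (g : ℕ)
    (M : lp (fun _ : SurfaceGroup g => ℂ) 2 →L[ℂ] lp (fun _ : SurfaceGroup g => ℂ) 2) :
    Prop :=
  ∀ (f : lp (fun _ : SurfaceGroup g => ℂ) 2) (x : SurfaceGroup g),
    M f x = (4 * (g : ℂ))⁻¹ * ∑ s ∈ Sgen g, f (x * s)

namespace FreeGroup

variable {α : Type*} [DecidableEq α]

theorem toWord_mk_singleton_mul (l : α × Bool) (w : FreeGroup α) :
    (mk [l] * w).toWord =
      if w.toWord.head? = some (l.1, !l.2) then w.toWord.tail else l :: w.toWord := by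
  have h : (mk [l] * w).toWord = reduce (l :: w.toWord) := by
    conv_lhs => rw [← mk_toWord (x := w), mul_mk, toWord_mk]
    rfl
  rw [h, reduce.cons, reduce_toWord]
  obtain ⟨a, b⟩ := l
  cases w.toWord with
  | nil => simp
  | cons hd tl =>
    obtain ⟨c, d⟩ := hd
    simp only [List.head?_cons, Option.some.injEq, Prod.mk.injEq, List.tail_cons]
    refine if_congr ?_ rfl rfl
    cases b <;> cases d <;> simp [eq_comm]

/-- The function `w ↦ r ^ |w|` with `r = 1 / √(2k - 1)` is superharmonic, for the eigenvalue
`2 √(2k - 1)`, with respect to the adjacency operator of the Cayley tree of rank `k`. -/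
theorem sum_pow_norm_mk_singleton_mul_le [Fintype α] {t : ℝ} (ht : 0 < t)
    (hcard : (Fintype.card (α × Bool) : ℝ) = t ^ 2 + 1) (h1 : 1 ≤ t) (w : FreeGroup α) :
    ∑ l : α × Bool, t⁻¹ ^ (mk [l] * w).norm ≤ 2 * t * t⁻¹ ^ w.norm := by
  simp only [norm, toWord_mk_singleton_mul]
  cases hw : w.toWord with
  | nil =>
    simp only [List.head?_nil, reduceCtorEq, if_false, List.length_cons, List.length_nil,
      Finset.sum_const, Finset.card_univ, nsmul_eq_mul, hcard]
    rw [zero_add, pow_one, pow_zero, mul_one, ← div_eq_mul_inv, div_le_iff₀ ht]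
    nlinarith
  | cons hd tl =>
    have key : ∀ l : α × Bool,
        t⁻¹ ^ (if (hd :: tl).head? = some (l.1, !l.2) then (hd :: tl).tail
          else l :: hd :: tl).length
          = t⁻¹ ^ (tl.length + 2) +
            if l = (hd.1, !hd.2) then t⁻¹ ^ tl.length - t⁻¹ ^ (tl.length + 2) else 0 := by
      rintro ⟨a, b⟩
      obtain ⟨c, d⟩ := hd
      by_cases hac : c = a
      · subst hac
        cases b <;> cases d <;> simp
      · have hca : a ≠ c := fun h => hac h.symm
        simp [hac, hca]
    rw [Finset.sum_congr rfl fun l _ => key l, Finset.sum_add_distrib]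
    simp only [Finset.sum_const, Finset.card_univ, nsmul_eq_mul, hcard, Finset.sum_ite_eq',
      Finset.mem_univ, if_true, List.length_cons]
    have hti : t * t⁻¹ = 1 := mul_inv_cancel₀ ht.ne'
    generalize t⁻¹ = r at hti
    apply le_of_eq
    linear_combination r ^ tl.length * (t * r - 1) * hti

end FreeGroup

/-- The Schur test for a symmetric family of right translations of a group, with respect to a
positive superharmonic function `h`. -/
theorem summable_sq_sum_mul_right_and_tsum_le {G ι : Type*} [Group G] [Fintype ι] (s : ι → G)
    (σ : Equiv.Perm ι) (hσ : ∀ i, s (σ i) = (s i)⁻¹) (h : G → ℝ) (hpos : ∀ x, 0 < h x) {C : ℝ}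
    (hC : ∀ x, ∑ i, h (x * s i) ≤ C * h x) (u : G → ℝ) (hu : Summable fun x => u x ^ 2) :
    (Summable fun x => (∑ i, u (x * s i)) ^ 2) ∧
      ∑' x, (∑ i, u (x * s i)) ^ 2 ≤ C ^ 2 * ∑' x, u x ^ 2 := by
  have hC0 : 0 ≤ C := by
    have h0 := (Finset.sum_nonneg fun i _ => (hpos (1 * s i)).le).trans (hC 1)
    exact nonneg_of_mul_nonneg_left h0 (hpos 1)
  have hle : ∀ i x, h (x * s i) ≤ C * h x := fun i x =>
    (Finset.single_le_sum (f := fun i => h (x * s i)) (fun j _ => (hpos _).le)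
      (Finset.mem_univ i)).trans (hC x)
  obtain ⟨c, hc⟩ : ∃ c : ι → G → ℝ, ∀ i y, c i y = h (y * (s i)⁻¹) / h y * u y ^ 2 :=
    ⟨_, fun _ _ => rfl⟩
  have hcs : ∀ i, Summable (c i) := fun i => by
    refine Summable.of_nonneg_of_le (fun y => ?_) (fun y => ?_) (hu.mul_left C)
      <;> rw [hc]
    · have := hpos (y * (s i)⁻¹)
      have := hpos y
      positivity
    · refine mul_le_mul_of_nonneg_right ?_ (sq_nonneg _)
      rw [div_le_iff₀ (hpos y), ← hσ]
      exact hle _ _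
  have hct : ∀ i, Summable fun x => c i (x * s i) := fun i =>
    (Equiv.mulRight (s i)).summable_iff.mpr (hcs i)
  have hpt : ∀ x, (∑ i, u (x * s i)) ^ 2 ≤ C * ∑ i, c i (x * s i) := fun x => by
    have cs := Finset.sum_sq_le_sum_mul_sum_of_sq_le_mul Finset.univ
      (r := fun i => u (x * s i)) (f := fun i => h (x * s i))
      (g := fun i => u (x * s i) ^ 2 / h (x * s i)) (fun i _ => (hpos _).le)
      (fun i _ => div_nonneg (sq_nonneg _) (hpos _).le)
      (fun i _ => (mul_div_cancel₀ (u (x * s i) ^ 2) (hpos (x * s i)).ne').ge)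
    refine cs.trans ((mul_le_mul_of_nonneg_right (hC x) (Finset.sum_nonneg fun i _ =>
      div_nonneg (sq_nonneg _) (hpos _).le)).trans_eq ?_)
    rw [mul_assoc, Finset.mul_sum]
    congr 1
    refine Finset.sum_congr rfl fun i _ => ?_
    simp only [hc, mul_inv_cancel_right]
    ring
  have hsum : Summable fun x => C * ∑ i, c i (x * s i) :=
    (summable_sum fun i _ => hct i).mul_left C
  have hS := Summable.of_nonneg_of_le (fun x => sq_nonneg _) hpt hsum
  refine ⟨hS, (hS.tsum_le_tsum hpt hsum).trans ?_⟩
  rw [tsum_mul_left, sq, mul_assoc]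
  refine mul_le_mul_of_nonneg_left ?_ hC0
  have htr : ∀ i, ∑' x, c i (x * s i) = ∑' x, c i x := fun i =>
    (Equiv.mulRight (s i)).tsum_eq (c i)
  rw [Summable.tsum_finsetSum fun i _ => hct i]
  simp only [htr]
  rw [← Summable.tsum_finsetSum fun i _ => hcs i, ← tsum_mul_left]
  refine (summable_sum fun i _ => hcs i).tsum_le_tsum (fun y => ?_) (hu.mul_left C)
  simp only [hc]
  rw [← Finset.sum_mul, ← Finset.sum_div]
  refine mul_le_mul_of_nonneg_right ?_ (sq_nonneg _)
  rw [div_le_iff₀ (hpos y)]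
  simp only [← hσ]
  rw [Equiv.sum_comp σ fun i => h (y * s i)]
  exact hC y

/-- The retraction of `Γ_g` onto the free group on the `a_j` (if `w = false`) or on the `b_j`
(if `w = true`), killing the other half of the generators. -/
def surfaceToFree (g : ℕ) (w : Bool) : SurfaceGroup g →* FreeGroup (Fin g) :=
  PresentedGroup.toGroup (f := fun p => if p.2 = w then FreeGroup.of p.1 else 1) (by
    rintro _ rfl
    rw [surfaceRel, map_list_prod, List.map_map]
    refine List.prod_eq_one fun x hx => ?_
    obtain ⟨j, -, rfl⟩ := List.mem_map.mp hx
    cases w <;> simp)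

theorem surfaceToFree_sgenFun (g : ℕ) (w : Bool) (l : Fin g × Bool) :
    surfaceToFree g w (sgenFun g (l.1, w, l.2)) = (FreeGroup.mk [l])⁻¹ := by
  obtain ⟨j, i⟩ := l
  cases i <;> simp [sgenFun, surfaceToFree, FreeGroup.of, FreeGroup.inv_mk, FreeGroup.invRev]

theorem sgenFun_half_sq_sum (g : ℕ) (hg : 1 ≤ g) (w : Bool) (u : SurfaceGroup g → ℝ)
    (hu : Summable fun x => u x ^ 2) :
    (Summable fun x => (∑ l : Fin g × Bool, u (x * sgenFun g (l.1, w, l.2))) ^ 2) ∧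
      ∑' x, (∑ l : Fin g × Bool, u (x * sgenFun g (l.1, w, l.2))) ^ 2 ≤
        4 * (2 * g - 1) * ∑' x, u x ^ 2 := by
  have hg' : (1 : ℝ) ≤ g := by exact_mod_cast hg
  set t := √(2 * (g : ℝ) - 1) with ht
  have ht2 : t ^ 2 = 2 * g - 1 := Real.sq_sqrt (by linarith)
  have ht1 : 1 ≤ t := Real.one_le_sqrt.mpr (by linarith)
  have ht0 : 0 < t := by linarith
  have key := summable_sq_sum_mul_right_and_tsum_le
    (fun l : Fin g × Bool => sgenFun g (l.1, w, l.2))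
    ((Equiv.refl (Fin g)).prodCongr Equiv.boolNot)
    (by rintro ⟨j, i⟩; cases i <;> simp [sgenFun])
    (fun x => t⁻¹ ^ (surfaceToFree g w x)⁻¹.norm) (fun x => by positivity) (C := 2 * t)
    (fun x => by
      simp only [map_mul, surfaceToFree_sgenFun, mul_inv_rev, inv_inv]
      refine FreeGroup.sum_pow_norm_mk_singleton_mul_le ht0 ?_ ht1 _
      rw [ht2]
      simp
      ring) u hu
  rwa [mul_pow, ht2, show (2 : ℝ) ^ 2 = 4 by norm_num] at key

theorem norm_sum_Sgen_le {E : Type*} [SeminormedAddCommGroup E] (g : ℕ)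
    (f : SurfaceGroup g → E) :
    ‖∑ s ∈ Sgen g, f s‖ ≤
      ∑ w : Bool, ∑ l : Fin g × Bool, ‖f (sgenFun g (l.1, w, l.2))‖ := by
  classical
  refine (norm_sum_le _ _).trans ?_
  have h : ∑ s ∈ Sgen g, ‖f s‖ ≤ ∑ p : Fin g × Bool × Bool, ‖f (sgenFun g p)‖ := by
    rw [Sgen, ← Finset.sum_fiberwise_of_maps_to
      fun p _ => Finset.mem_image_of_mem (sgenFun g) (Finset.mem_univ p)]
    refine Finset.sum_le_sum fun s hs => ?_
    obtain ⟨p, -, rfl⟩ := Finset.mem_image.mp hs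
    exact Finset.single_le_sum (f := fun q => ‖f (sgenFun g q)‖) (fun _ _ => norm_nonneg _)
      (Finset.mem_filter.mpr ⟨Finset.mem_univ p, rfl⟩)
  refine h.trans_eq ?_
  simp only [Fintype.sum_prod_type, Fintype.sum_bool, Finset.sum_add_distrib]

/-- Section 1: for every `g ≥ 2`, `μ_g ≤ √(2g−1)/g` (in particular
`μ_2 ≤ √3/2`, the case `g = 2`). -/
theorem mu_le_sqrt_two_g_sub_one_div_g (g : ℕ) (hg : 2 ≤ g)
    (M : lp (fun _ : SurfaceGroup g => ℂ) 2 →L[ℂ] lp (fun _ : SurfaceGroup g => ℂ) 2)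
    (hM : IsMarkov g M) :
    ‖M‖ ≤ Real.sqrt (2 * (g : ℝ) - 1) / g := by
  have hg0 : (0 : ℝ) < g := by exact_mod_cast (by omega : 0 < g)
  have hq : (0 : ℝ) ≤ 2 * g - 1 := by
    have : (2 : ℝ) ≤ g := by exact_mod_cast hg
    linarith
  refine M.opNorm_le_bound (by positivity) fun f => ?_
  refine le_of_sq_le_sq ?_ (by positivity)
  have norm_sq : ∀ k : lp (fun _ : SurfaceGroup g => ℂ) 2, HasSum (fun x => ‖k x‖ ^ 2) (‖k‖ ^ 2) :=
    fun k => by simpa using lp.hasSum_norm (p := 2) (by norm_num) k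
  have hu := norm_sq f
  obtain ⟨hA, hA'⟩ := sgenFun_half_sq_sum g (by omega) false (fun x => ‖f x‖) hu.summable
  obtain ⟨hB, hB'⟩ := sgenFun_half_sq_sum g (by omega) true (fun x => ‖f x‖) hu.summable
  rw [hu.tsum_eq] at hA' hB'
  have hpt : ∀ x, ‖M f x‖ ^ 2 ≤ (8 * (g : ℝ) ^ 2)⁻¹ *
      ((∑ l : Fin g × Bool, ‖f (x * sgenFun g (l.1, false, l.2))‖) ^ 2 +
        (∑ l : Fin g × Bool, ‖f (x * sgenFun g (l.1, true, l.2))‖) ^ 2) := fun x => by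
    have h := norm_sum_Sgen_le g fun s => f (x * s)
    rw [Fintype.sum_bool, add_comm] at h
    have h4 : ‖(4 * (g : ℂ))⁻¹‖ = (4 * (g : ℝ))⁻¹ := by simp
    rw [hM f x, norm_mul, mul_pow, h4]
    calc _ ≤ ((4 * (g : ℝ))⁻¹) ^ 2 * _ :=
          mul_le_mul_of_nonneg_left
            ((pow_le_pow_left₀ (norm_nonneg _) h 2).trans add_sq_le) (sq_nonneg _)
      _ = _ := by field_simp; ring
  calc ‖M f‖ ^ 2 = ∑' x, ‖M f x‖ ^ 2 := (norm_sq _).tsum_eq.symm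
    _ ≤ _ := (norm_sq _).summable.tsum_le_tsum hpt ((hA.add hB).mul_left _)
    _ = (8 * (g : ℝ) ^ 2)⁻¹ * (_ + _) := by rw [tsum_mul_left, hA.tsum_add hB]
    _ ≤ (8 * (g : ℝ) ^ 2)⁻¹ *
        (4 * (2 * g - 1) * ‖f‖ ^ 2 + 4 * (2 * g - 1) * ‖f‖ ^ 2) := by gcongr
    _ = (√(2 * g - 1) / g * ‖f‖) ^ 2 := by
        rw [mul_pow, div_pow, Real.sq_sqrt hq]
        field_simp
        ring
end
end

section
/- For every integer g ≥ 2 one has μ_g ≤ √(4g−2)/(2g) + 1/(4g); in particular μ_2 ≤ √6/4 + 1/8. -/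
open scoped Real

noncomputable section

/-- **Schur test** on a group: a positive function `h` with `∑ i, h (x * s i) ≤ c * h x` bounds the
`ℓ²` norm of the convolution operator `u ↦ (x ↦ ∑ i, u (x * s i))` by `c`, when the family `s` is
symmetric. -/
theorem sum_sq_sum_mul_right_le {G ι : Type*} [Group G] [Fintype ι] (s : ι → G) (σ : ι ≃ ι)
    (hσ : ∀ i, s (σ i) = (s i)⁻¹) (h : G → ℝ) (hpos : ∀ x, 0 < h x) {c : ℝ}
    (hc : ∀ x, ∑ i, h (x * s i) ≤ c * h x) (hc0 : 0 ≤ c) (u : G → ℝ) {B : ℝ}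
    (hB : ∀ Y : Finset G, ∑ y ∈ Y, u y ^ 2 ≤ B) (X : Finset G) :
    ∑ x ∈ X, (∑ i, u (x * s i)) ^ 2 ≤ c ^ 2 * B := by
  classical
  have hc' (y : G) : ∑ i, h (y * (s i)⁻¹) ≤ c * h y := by
    refine le_trans (le_of_eq ?_) (hc y)
    simp_rw [← hσ]
    exact Equiv.sum_comp σ fun i => h (y * s i)
  have cauchy (x : G) : (∑ i, u (x * s i)) ^ 2 ≤
      c * ∑ i, h (x * s i * (s i)⁻¹) / h (x * s i) * u (x * s i) ^ 2 := by
    have key : (∑ i, u (x * s i)) ^ 2 ≤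
        (∑ i, h (x * s i)) * ∑ i, u (x * s i) ^ 2 / h (x * s i) :=
      Finset.sum_sq_le_sum_mul_sum_of_sq_le_mul _ (fun i _ => (hpos _).le)
        (fun i _ => div_nonneg (sq_nonneg _) (hpos _).le)
        (fun i _ => (mul_div_cancel₀ _ (hpos _).ne').ge)
    refine key.trans ?_
    have hnn : 0 ≤ ∑ i, u (x * s i) ^ 2 / h (x * s i) :=
      Finset.sum_nonneg fun i _ => div_nonneg (sq_nonneg _) (hpos _).le
    refine (mul_le_mul_of_nonneg_right (hc x) hnn).trans (le_of_eq ?_)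
    rw [mul_assoc, Finset.mul_sum]
    congr 1
    refine Finset.sum_congr rfl fun i _ => ?_
    rw [mul_inv_cancel_right]
    ring
  set Y : Finset G := Finset.univ.biUnion fun i => X.image (· * s i) with hY
  have hF (i : ι) (F : G → ℝ) (hF0 : ∀ y, 0 ≤ F y) : ∑ x ∈ X, F (x * s i) ≤ ∑ y ∈ Y, F y := by
    rw [← Finset.sum_image (f := F) (g := (· * s i)) fun _ _ _ _ e => mul_right_cancel e]
    refine Finset.sum_le_sum_of_subset_of_nonneg (fun y hy => ?_) fun y _ _ => hF0 y
    exact Finset.mem_biUnion.2 ⟨i, Finset.mem_univ _, hy⟩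
  calc ∑ x ∈ X, (∑ i, u (x * s i)) ^ 2
      ≤ ∑ x ∈ X, c * ∑ i, h (x * s i * (s i)⁻¹) / h (x * s i) * u (x * s i) ^ 2 :=
        Finset.sum_le_sum fun x _ => cauchy x
    _ = c * ∑ i, ∑ x ∈ X, h (x * s i * (s i)⁻¹) / h (x * s i) * u (x * s i) ^ 2 := by
        rw [← Finset.mul_sum, Finset.sum_comm]
    _ ≤ c * ∑ i, ∑ y ∈ Y, h (y * (s i)⁻¹) / h y * u y ^ 2 := by
        refine mul_le_mul_of_nonneg_left (Finset.sum_le_sum fun i _ => ?_) hc0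
        exact hF i (fun y => h (y * (s i)⁻¹) / h y * u y ^ 2) fun y =>
          mul_nonneg (div_nonneg (hpos _).le (hpos _).le) (sq_nonneg _)
    _ = c * ∑ y ∈ Y, (∑ i, h (y * (s i)⁻¹)) / h y * u y ^ 2 := by
        rw [Finset.sum_comm]
        simp_rw [← Finset.sum_mul, ← Finset.sum_div]
    _ ≤ c * ∑ y ∈ Y, c * u y ^ 2 := by
        refine mul_le_mul_of_nonneg_left (Finset.sum_le_sum fun y _ => ?_) hc0
        exact mul_le_mul_of_nonneg_right ((div_le_iff₀ (hpos y)).2 (hc' y)) (sq_nonneg _)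
    _ = c ^ 2 * ∑ y ∈ Y, u y ^ 2 := by rw [← Finset.mul_sum]; ring
    _ ≤ c ^ 2 * B := mul_le_mul_of_nonneg_left (hB Y) (sq_nonneg _)

/-- A Markov operator on the surface group has norm at most `c / (4g)` as soon as there is a
positive function whose sums over neighbours are at most `c` times its value. -/
theorem IsMarkov.norm_le {g : ℕ}
    {M : lp (fun _ : SurfaceGroup g => ℂ) 2 →L[ℂ] lp (fun _ : SurfaceGroup g => ℂ) 2}
    (hM : IsMarkov g M) (h : SurfaceGroup g → ℝ) (hpos : ∀ x, 0 < h x) {c : ℝ} (hc0 : 0 ≤ c)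
    (hc : ∀ x, ∑ p, h (x * sgenFun g p) ≤ c * h x) : ‖M‖ ≤ c / (4 * g) := by
  classical
  have hp : (0 : ℝ) < (2 : ENNReal).toReal := by norm_num
  refine M.opNorm_le_bound (by positivity) fun f => ?_
  refine lp.norm_le_of_forall_sum_le hp (by positivity) fun X => ?_
  have two : (2 : ENNReal).toReal = ((2 : ℕ) : ℝ) := by norm_num
  simp only [two, Real.rpow_natCast]
  have hB (Y : Finset (SurfaceGroup g)) : ∑ y ∈ Y, ‖f y‖ ^ 2 ≤ ‖f‖ ^ 2 := by
    have := lp.sum_rpow_le_norm_rpow hp f Y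
    simpa only [two, Real.rpow_natCast] using this
  have hpt (x : SurfaceGroup g) :
      ‖M f x‖ ≤ (4 * (g : ℝ))⁻¹ * ∑ p, ‖f (x * sgenFun g p)‖ := by
    rw [hM f x, norm_mul]
    refine mul_le_mul (by simp) ?_ (norm_nonneg _) (by positivity)
    refine (norm_sum_le _ _).trans ?_
    exact Finset.sum_image_le_of_nonneg (g := sgenFun g) (f := fun s => ‖f (x * s)‖)
      fun _ _ => norm_nonneg _
  let σ : Fin g × Bool × Bool ≃ Fin g × Bool × Bool :=
    (Equiv.refl _).prodCongr ((Equiv.refl _).prodCongr Equiv.boolNot)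
  have hσ (p) : sgenFun g (σ p) = (sgenFun g p)⁻¹ := by
    obtain ⟨j, w, i⟩ := p
    cases i <;> simp [σ, sgenFun]
  calc ∑ x ∈ X, ‖M f x‖ ^ 2
      ≤ ∑ x ∈ X, ((4 * (g : ℝ))⁻¹ * ∑ p, ‖f (x * sgenFun g p)‖) ^ 2 :=
        Finset.sum_le_sum fun x _ => pow_le_pow_left₀ (norm_nonneg _) (hpt x) 2
    _ = ((4 * (g : ℝ))⁻¹) ^ 2 * ∑ x ∈ X, (∑ p, ‖f (x * sgenFun g p)‖) ^ 2 := by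
        simp_rw [mul_pow, ← Finset.mul_sum]
    _ ≤ ((4 * (g : ℝ))⁻¹) ^ 2 * (c ^ 2 * ‖f‖ ^ 2) :=
        mul_le_mul_of_nonneg_left
          (sum_sq_sum_mul_right_le _ σ hσ h hpos hc hc0 (fun y => ‖f y‖) hB X) (sq_nonneg _)
    _ = (c / (4 * g) * ‖f‖) ^ 2 := by ring

section FreeProduct

open Monoid

/-- The free product of `g` copies of `ℤ²`. -/
abbrev FreeProdZ2 (g : ℕ) := CoprodI fun _ : Fin g => Multiplicative (ℤ × ℤ)

/-- The element of `ℤ²` to which the generator `a_j` (`false`) or `b_j` (`true`) is sent. -/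
def z2Gen (w : Bool) : ℤ × ℤ := if w then (0, 1) else (1, 0)

/-- The homomorphism from the surface group to the free product of `g` copies of `ℤ²` that sends
`a_j` and `b_j` to the standard generators of the `j`-th copy. -/
def toFreeProdZ2 (g : ℕ) : SurfaceGroup g →* FreeProdZ2 g :=
  PresentedGroup.toGroup
    (f := fun p : Fin g × Bool => CoprodI.of (i := p.1) (Multiplicative.ofAdd (z2Gen p.2))) <| by
      rintro r rfl
      rw [surfaceRel, map_list_prod, List.map_map]
      refine List.prod_eq_one fun x hx => ?_
      obtain ⟨j, -, rfl⟩ := List.mem_map.1 hx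
      simp only [Function.comp_apply, map_mul, map_inv, FreeGroup.lift_apply_of]
      simp only [← map_inv, ← map_mul]
      rw [mul_comm (Multiplicative.ofAdd (z2Gen false)), mul_inv_cancel_right, mul_inv_cancel,
        map_one]

theorem toFreeProdZ2_sgenFun {g : ℕ} (j : Fin g) (w i : Bool) :
    (toFreeProdZ2 g (sgenFun g (j, w, i)))⁻¹ = CoprodI.of (i := j)
      (Multiplicative.ofAdd (if i then z2Gen w else -z2Gen w)) := by
  cases i <;> simp [sgenFun, toFreeProdZ2, PresentedGroup.toGroup.of, ofAdd_neg]

/-- The product over the letters of a reduced word of the values of `φ`. -/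
def wordWeight {g : ℕ} (φ : ℤ × ℤ → ℝ)
    (w : CoprodI.Word fun _ : Fin g => Multiplicative (ℤ × ℤ)) : ℝ :=
  (w.toList.map fun l => φ l.2.toAdd).prod

theorem wordWeight_pos {g : ℕ} {φ : ℤ × ℤ → ℝ} (hφ : ∀ v, 0 < φ v)
    (w : CoprodI.Word fun _ : Fin g => Multiplicative (ℤ × ℤ)) : 0 < wordWeight φ w :=
  List.prod_pos fun x hx => by
    obtain ⟨l, -, rfl⟩ := List.mem_map.1 hx
    exact hφ _

theorem wordWeight_rcons {g : ℕ} {φ : ℤ × ℤ → ℝ} (hφ : φ 0 = 1) {j : Fin g}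
    (p : CoprodI.Word.Pair (fun _ : Fin g => Multiplicative (ℤ × ℤ)) j) :
    wordWeight φ (CoprodI.Word.rcons p) = φ p.head.toAdd * wordWeight φ p.tail := by
  unfold CoprodI.Word.rcons
  split_ifs with h
  · simp [h, hφ]
  · simp [wordWeight]

/-- The sum of the values of `φ` at the four neighbours of `v` in `ℤ²`. -/
def sumNeighbors (φ : ℤ × ℤ → ℝ) (v : ℤ × ℤ) : ℝ :=
  φ (v.1 + 1, v.2) + φ (v.1 - 1, v.2) + (φ (v.1, v.2 + 1) + φ (v.1, v.2 - 1))

theorem sum_wordWeight_smul {g : ℕ} {φ : ℤ × ℤ → ℝ} (hφ : φ 0 = 1) (j : Fin g)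
    (w : CoprodI.Word fun _ : Fin g => Multiplicative (ℤ × ℤ)) :
    ∑ q : Bool × Bool, wordWeight φ
      (CoprodI.of (M := fun _ : Fin g => Multiplicative (ℤ × ℤ)) (i := j)
        (Multiplicative.ofAdd (if q.2 then z2Gen q.1 else -z2Gen q.1)) • w) =
      sumNeighbors φ (CoprodI.Word.equivPair j w).head.toAdd *
        wordWeight φ (CoprodI.Word.equivPair j w).tail := by
  simp only [CoprodI.Word.of_smul_def, wordWeight_rcons hφ, Fintype.sum_prod_type, Fintype.sum_bool,
    ← Finset.sum_mul, sumNeighbors, toAdd_mul, toAdd_ofAdd, z2Gen]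
  generalize (CoprodI.Word.equivPair j w).head.toAdd = v
  obtain ⟨m, n⟩ := v
  simp [sub_eq_add_neg, add_comm]

/-- A positive function `φ` on `ℤ²` whose neighbour sums are at most `z φ` away from the origin
extends multiplicatively to a supersolution on the free product of `g` copies of `ℤ²`. -/
theorem sum_wordWeight_smul_le {g : ℕ} {φ : ℤ × ℤ → ℝ} (hφ : φ 0 = 1) (hpos : ∀ v, 0 < φ v)
    {z : ℝ} (hz : ∀ v ≠ 0, sumNeighbors φ v ≤ z * φ v) (h0 : sumNeighbors φ 0 ≤ z)
    (hg : 1 ≤ g)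
    (w : CoprodI.Word fun _ : Fin g => Multiplicative (ℤ × ℤ)) :
    ∑ j : Fin g, ∑ q : Bool × Bool, wordWeight φ
      (CoprodI.of (M := fun _ : Fin g => Multiplicative (ℤ × ℤ)) (i := j)
        (Multiplicative.ofAdd (if q.2 then z2Gen q.1 else -z2Gen q.1)) • w) ≤
      (z + (g - 1) * sumNeighbors φ 0) * wordWeight φ w := by
  have hW := wordWeight_pos hpos w
  have off (j : Fin g) (hj : w.fstIdx ≠ some j) : sumNeighbors φ
      (CoprodI.Word.equivPair j w).head.toAdd * wordWeight φ (CoprodI.Word.equivPair j w).tail =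
      sumNeighbors φ 0 * wordWeight φ w := by
    rw [CoprodI.Word.equivPair_eq_of_fstIdx_ne hj, toAdd_one]
  have all (j : Fin g) : sumNeighbors φ
      (CoprodI.Word.equivPair j w).head.toAdd * wordWeight φ (CoprodI.Word.equivPair j w).tail ≤
      z * wordWeight φ w := by
    have hw : wordWeight φ w = φ (CoprodI.Word.equivPair j w).head.toAdd *
        wordWeight φ (CoprodI.Word.equivPair j w).tail := by
      rw [← wordWeight_rcons hφ, ← CoprodI.Word.equivPair_symm, Equiv.symm_apply_apply]
    rw [hw, ← mul_assoc]
    refine mul_le_mul_of_nonneg_right ?_ (wordWeight_pos hpos _).le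
    by_cases hv : (CoprodI.Word.equivPair j w).head.toAdd = 0
    · rw [hv, hφ, mul_one]; exact h0
    · exact hz _ hv
  simp_rw [sum_wordWeight_smul hφ]
  obtain ⟨k, hk⟩ : ∃ k : Fin g, ∀ j, j ≠ k → w.fstIdx ≠ some j := by
    cases hw : w.fstIdx with
    | none => exact ⟨⟨0, hg⟩, by simp⟩
    | some k => exact ⟨k, fun j hj e => hj (Option.some_injective _ e).symm⟩
  rw [← Finset.add_sum_erase _ _ (Finset.mem_univ k),
    Finset.sum_congr rfl fun j hj => off j (hk j (Finset.ne_of_mem_erase hj)), Finset.sum_const,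
    Finset.card_erase_of_mem (Finset.mem_univ k), Finset.card_univ, Fintype.card_fin, nsmul_eq_mul,
    Nat.cast_sub hg, Nat.cast_one, add_mul, mul_assoc]
  exact add_le_add_left (all k) _

theorem IsMarkov.norm_le_of_sumNeighbors_le {g : ℕ} (hg : 1 ≤ g)
    {M : lp (fun _ : SurfaceGroup g => ℂ) 2 →L[ℂ] lp (fun _ : SurfaceGroup g => ℂ) 2}
    (hM : IsMarkov g M) {φ : ℤ × ℤ → ℝ} (hφ : φ 0 = 1) (hpos : ∀ v, 0 < φ v)
    {z : ℝ} (hz : ∀ v ≠ 0, sumNeighbors φ v ≤ z * φ v) (h0 : sumNeighbors φ 0 ≤ z) :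
    ‖M‖ ≤ (z + (g - 1) * sumNeighbors φ 0) / (4 * g) := by
  have hs : 0 ≤ sumNeighbors φ 0 := by
    unfold sumNeighbors
    have := fun v => (hpos v).le
    exact add_nonneg (add_nonneg (this _) (this _)) (add_nonneg (this _) (this _))
  have hg' : (1 : ℝ) ≤ g := by exact_mod_cast hg
  refine hM.norm_le
    (fun x => wordWeight φ ((toFreeProdZ2 g x)⁻¹ •
      (CoprodI.Word.empty : CoprodI.Word fun _ : Fin g => Multiplicative (ℤ × ℤ))))
    (fun x => wordWeight_pos hpos _) (add_nonneg (hs.trans h0) (mul_nonneg (by linarith) hs))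
    fun x => ?_
  rw [Fintype.sum_prod_type]
  refine le_of_eq_of_le (Finset.sum_congr rfl fun j _ => Finset.sum_congr rfl fun q _ => ?_)
    (sum_wordWeight_smul_le hφ hpos hz h0 hg _)
  rw [map_mul, mul_inv_rev, mul_smul, toFreeProdZ2_sgenFun]

end FreeProduct

/-- A radially decaying function on `ℕ²`, with prescribed values near the origin. -/
def decay (p q t T α : ℝ) : ℕ → ℕ → ℝ
  | 0, 0 => 1
  | 1, 0 => p
  | 0, 1 => p
  | 1, 1 => q
  | 2, 0 => t
  | 0, 2 => t
  | a, b => T * α ^ (a + b - 2)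

theorem decay_pos {p q t T α : ℝ} (hp : 0 < p) (hq : 0 < q) (ht : 0 < t) (hT : 0 < T)
    (hα : 0 < α) (a b : ℕ) : 0 < decay p q t T α a b := by
  unfold decay
  split <;> positivity

/-- The distance from the origin to the neighbour of `a` in `ℤ` on the side of the origin. -/
def inner1 (a : ℕ) : ℕ := if a = 0 then 1 else a - 1

theorem apply_natAbs_add_one_add (f : ℕ → ℝ) (m : ℤ) :
    f (m + 1).natAbs + f (m - 1).natAbs = f (m.natAbs + 1) + f (inner1 m.natAbs) := by
  unfold inner1
  rcases lt_trichotomy m 0 with h | rfl | h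
  · rw [if_neg (by omega), show (m + 1).natAbs = m.natAbs - 1 by omega,
      show (m - 1).natAbs = m.natAbs + 1 by omega, add_comm]
  · simp
  · rw [if_neg (by omega), show (m + 1).natAbs = m.natAbs + 1 by omega,
      show (m - 1).natAbs = m.natAbs - 1 by omega]

theorem decay_of_three_le (p q t T α : ℝ) {a b : ℕ} (h : 3 ≤ a + b) :
    decay p q t T α a b = T * α ^ (a + b - 2) := by
  unfold decay
  split <;> first | omega | rfl

theorem decay_supersolution {p q t T α z : ℝ} (hT : 0 < T) (hα : 0 < α) (hα1 : α ≤ 1)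
    (hz : z * α = 2 * α ^ 2 + 2) (h10 : 1 + t + 2 * q ≤ z * p) (h20 : p + 3 * (T * α) ≤ z * t)
    (h11 : 2 * p + 2 * (T * α) ≤ z * q) (h21 : q + t ≤ 2 * T) (htT : t ≤ T)
    (a b : ℕ) (hab : ¬ (a = 0 ∧ b = 0)) :
    decay p q t T α (a + 1) b + decay p q t T α (inner1 a) b +
      (decay p q t T α a (b + 1) + decay p q t T α a (inner1 b)) ≤ z * decay p q t T α a b := by
  have key (k : ℕ) : z * (T * α ^ (k + 1)) = 2 * (T * α ^ (k + 2)) + 2 * (T * α ^ k) := by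
    linear_combination (T * α ^ k) * hz
  have mono (k : ℕ) : T * α ^ (k + 2) ≤ T * α ^ k :=
    mul_le_mul_of_nonneg_left (pow_le_pow_of_le_one hα.le hα1 (by omega)) hT.le
  rcases lt_or_ge (a + b) 4 with h | h
  · have k0 := key 0
    have m0 := mono 0
    have ha : a < 4 := by omega
    have hb : b < 4 := by omega
    simp only [zero_add, pow_one, pow_zero, mul_one] at k0 m0
    interval_cases a <;> interval_cases b <;>
      first
      | omega
      | (simp [decay, inner1] at hab ⊢; linarith)
  · obtain ⟨k, hk⟩ := Nat.exists_eq_add_of_le' h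
    have up (a' b' : ℕ) (h' : a' + b' = k + 5) : decay p q t T α a' b' = T * α ^ (k + 3) := by
      rw [decay_of_three_le _ _ _ _ _ (by omega), h']; rfl
    have down (a' b' : ℕ) (h' : a' + b' = k + 3) : decay p q t T α a' b' = T * α ^ (k + 1) := by
      rw [decay_of_three_le _ _ _ _ _ (by omega), h']; rfl
    have here : decay p q t T α a b = T * α ^ (k + 2) := by
      rw [decay_of_three_le _ _ _ _ _ (by omega), hk]; rfl
    have inner_le (a' : ℕ) : a' = 0 ∧ inner1 a' = a' + 1 ∨ a' = inner1 a' + 1 := by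
      unfold inner1; split <;> omega
    have k1 := key (k + 1)
    have m1 := mono (k + 1)
    rw [here, k1, up (a + 1) b (by omega), up a (b + 1) (by omega)]
    rcases inner_le a with ⟨ha0, ha⟩ | ha <;> rcases inner_le b with ⟨hb0, hb⟩ | hb
    · omega
    · rw [up (inner1 a) b (by omega), down a (inner1 b) (by omega)]; linarith
    · rw [down (inner1 a) b (by omega), up a (inner1 b) (by omega)]; linarith
    · rw [down (inner1 a) b (by omega), down a (inner1 b) (by omega)]; linarith

/-- A norm bound for the Markov operator in terms of the parameters of `decay`. -/
theorem IsMarkov.norm_le_of_decay {g : ℕ} (hg : 1 ≤ g)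
    {M : lp (fun _ : SurfaceGroup g => ℂ) 2 →L[ℂ] lp (fun _ : SurfaceGroup g => ℂ) 2}
    (hM : IsMarkov g M) {p q t T α z : ℝ} (hp : 0 < p) (hq : 0 < q) (ht : 0 < t) (hT : 0 < T)
    (hα : 0 < α) (hα1 : α ≤ 1)
    (hz : z * α = 2 * α ^ 2 + 2) (h10 : 1 + t + 2 * q ≤ z * p) (h20 : p + 3 * (T * α) ≤ z * t)
    (h11 : 2 * p + 2 * (T * α) ≤ z * q) (h21 : q + t ≤ 2 * T) (htT : t ≤ T) (hpz : 4 * p ≤ z) :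
    ‖M‖ ≤ (z + (g - 1) * (4 * p)) / (4 * g) := by
  let φ : ℤ × ℤ → ℝ := fun v => decay p q t T α v.1.natAbs v.2.natAbs
  have hφ0 : sumNeighbors φ 0 = 4 * p := by
    simp [sumNeighbors, φ, decay]
    ring
  rw [← hφ0]
  refine hM.norm_le_of_sumNeighbors_le hg (by simp [decay])
    (fun v => decay_pos hp hq ht hT hα _ _) (fun v hv => ?_) (hφ0.trans_le hpz)
  unfold sumNeighbors
  rw [apply_natAbs_add_one_add (fun a => decay p q t T α a v.2.natAbs),
    apply_natAbs_add_one_add (fun b => decay p q t T α v.1.natAbs b)]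
  refine decay_supersolution hT hα hα1 hz h10 h20 h11 h21 htT _ _ fun h => hv ?_
  exact Prod.ext (Int.natAbs_eq_zero.1 h.1) (Int.natAbs_eq_zero.1 h.2)

/-- Section 3: for every `g ≥ 2`, `μ_g ≤ √(4g−2)/(2g) + 1/(4g)` (in particular
`μ_2 ≤ √6/4 + 1/8`, the case `g = 2`). -/
theorem mu_le_sqrt_four_g_sub_two (g : ℕ) (hg : 2 ≤ g)
    (M : lp (fun _ : SurfaceGroup g => ℂ) 2 →L[ℂ] lp (fun _ : SurfaceGroup g => ℂ) 2)
    (hM : IsMarkov g M) :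
    ‖M‖ ≤ Real.sqrt (4 * (g : ℝ) - 2) / (2 * g) + 1 / (4 * g) := by
  have hg0 : (0 : ℝ) < g := by exact_mod_cast (by omega : 0 < g)
  have target : Real.sqrt (4 * (g : ℝ) - 2) / (2 * g) + 1 / (4 * g) =
      (2 * Real.sqrt (4 * (g : ℝ) - 2) + 1) / (4 * g) := by
    field_simp
    ring
  rw [target]
  rcases hg.eq_or_lt with rfl | hg3
  · refine (hM.norm_le_of_decay (p := 89 / 250) (q := 53 / 250) (t := 79 / 500) (T := 37 / 200)
      (α := 5 / 8) (z := 89 / 20) (by norm_num) (by norm_num) (by norm_num) (by norm_num)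
      (by norm_num) (by norm_num) (by norm_num) (by norm_num) (by norm_num) (by norm_num)
      (by norm_num) (by norm_num) (by norm_num) (by norm_num)).trans ?_
    refine div_le_div_of_nonneg_right ?_ (by positivity)
    have : (2.44 : ℝ) ≤ Real.sqrt (4 * ((2 : ℕ) : ℝ) - 2) :=
      Real.le_sqrt_of_sq_le (by norm_num)
    norm_num at this ⊢
    linarith
  · obtain ⟨s, hs2, hs⟩ : ∃ s : ℝ, 2 ≤ s ∧ s ^ 2 = g + 1 := by
      have h3 : (3 : ℝ) ≤ g := by exact_mod_cast hg3
      exact ⟨Real.sqrt (g + 1), Real.le_sqrt_of_sq_le (by linarith), Real.sq_sqrt (by linarith)⟩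
    have hs0 : 0 < s := by linarith
    have hD : 0 < 2 * s ^ 2 - 1 := by nlinarith
    obtain ⟨r, hr⟩ : ∃ r : ℝ, r = 1 / s := ⟨_, rfl⟩
    obtain ⟨e, he⟩ : ∃ e : ℝ, e = 1 / (2 * s ^ 2 - 1) := ⟨_, rfl⟩
    have hr0 : 0 < r := by rw [hr]; positivity
    have he0 : 0 < e := by rw [he]; positivity
    have hrs : s * r = 1 := by rw [hr, mul_one_div_cancel hs0.ne']
    have hes : (2 * s ^ 2 - 1) * e = 1 := by rw [he, mul_one_div_cancel hD.ne']
    have hr1 : r ≤ 1 := by rw [hr, div_le_one hs0]; linarith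
    have he1 : e ≤ 1 / 2 := by nlinarith
    have bound := hM.norm_le_of_decay (p := s * e) (q := e) (t := e) (T := e) (α := r)
      (z := 2 * s + 2 * r) (by omega) (by positivity) he0 he0 he0 hr0 hr1
      (by linear_combination 2 * hrs) (by linear_combination -hes - 2 * e * hrs)
      (by nlinarith) (by linarith) (by linarith) le_rfl (by nlinarith)
    refine bound.trans (div_le_div_of_nonneg_right ?_ (by positivity))
    have hgs : (g : ℝ) = s ^ 2 - 1 := by linarith
    have hroot : (8 * s ^ 4 - 2 * s ^ 3 - 6 * s ^ 2 + s - 2) / (s * (2 * s ^ 2 - 1)) ≤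
        2 * Real.sqrt (4 * (g : ℝ) - 2) := by
      have : 2 * Real.sqrt (4 * (g : ℝ) - 2) = Real.sqrt (16 * s ^ 2 - 24) := by
        rw [show 16 * s ^ 2 - 24 = 2 ^ 2 * (4 * (g : ℝ) - 2) by rw [hgs]; ring,
          Real.sqrt_mul (by norm_num), Real.sqrt_sq (by norm_num)]
      rw [this]
      refine Real.le_sqrt_of_sq_le ?_
      rw [div_pow, div_le_iff₀ (by positivity)]
      obtain ⟨u, hu, rfl⟩ : ∃ u, 0 ≤ u ∧ s = 2 + u := ⟨s - 2, by linarith, by ring⟩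
      rw [← sub_nonneg]
      ring_nf
      positivity
    refine le_trans (le_of_eq ?_) (add_le_add_left hroot 1)
    rw [hgs, hr, he]
    field_simp
    ring
end
end

section
/- For every integer g ≥ 2 and every real number ν, one has μ_g ≤ sup_{0 ≤ φ ≤ 2π} F_g(ν, φ). -/
open scoped Real

noncomputable section

/-- The inverse hyperbolic cosine, `arcosh x = log (x + √(x² − 1))`. -/
def arcosh (x : ℝ) : ℝ := Real.log (x + Real.sqrt (x ^ 2 - 1))

/-- `D_g = 2 arccosh (cot (π/(4g)))`, the hyperbolic distance between the centres of
two adjacent cells of the tesselation of `H²` by regular `4g`-gons. -/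
def Dg (g : ℕ) : ℝ := 2 * arcosh (Real.tan (π / (4 * g)))⁻¹

/-- `b(ρ, φ) = 1/(cosh ρ − sinh ρ · cos φ)`. -/
def bker (ρ φ : ℝ) : ℝ := (Real.cosh ρ - Real.sinh ρ * Real.cos φ)⁻¹

/-- `F_g(ν, φ) = (1/(4g)) ∑_{j=0}^{4g−1} b(D_g, φ + j·2π/(4g))^ν`. -/
def Fg (g : ℕ) (ν φ : ℝ) : ℝ :=
  (4 * (g : ℝ))⁻¹ *
    ∑ j ∈ Finset.range (4 * g), bker (Dg g) (φ + j * (2 * π / (4 * g))) ^ ν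

/-! ### Schur test on a group -/

open scoped Classical in
theorem sum_sq_sum_mul_right_le_s2 {G : Type*} [Group G] (S : Finset G)
    (hS : ∀ s ∈ S, s⁻¹ ∈ S) (f u : G → ℝ) (hf : ∀ x, 0 < f x) {C : ℝ} (hC : 0 ≤ C)
    (hfS : ∀ x, ∑ s ∈ S, f (x * s) ≤ C * f x) (A : Finset G) :
    ∃ B : Finset G, ∑ x ∈ A, (∑ s ∈ S, u (x * s)) ^ 2 ≤ C ^ 2 * ∑ y ∈ B, u y ^ 2 := by
  set B : Finset G := (A ×ˢ S).image fun p => p.1 * p.2 with hB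
  refine ⟨B, ?_⟩
  have hnn : ∀ x y, 0 ≤ f x * (u y ^ 2 / f y) := fun x y =>
    mul_nonneg (hf x).le (div_nonneg (sq_nonneg _) (hf y).le)
  have hpt : ∀ x, (∑ s ∈ S, u (x * s)) ^ 2 ≤
      C * ∑ s ∈ S, f x * (u (x * s) ^ 2 / f (x * s)) := by
    intro x
    calc (∑ s ∈ S, u (x * s)) ^ 2
        ≤ (∑ s ∈ S, f (x * s)) * ∑ s ∈ S, u (x * s) ^ 2 / f (x * s) :=
          Finset.sum_sq_le_sum_mul_sum_of_sq_le_mul S (fun s _ => (hf _).le)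
            (fun s _ => div_nonneg (sq_nonneg _) (hf _).le)
            (fun s _ => by rw [mul_div_cancel₀ _ (hf (x * s)).ne'])
      _ ≤ (C * f x) * ∑ s ∈ S, u (x * s) ^ 2 / f (x * s) :=
          mul_le_mul_of_nonneg_right (hfS x)
            (Finset.sum_nonneg fun s _ => div_nonneg (sq_nonneg _) (hf _).le)
      _ = _ := by rw [mul_assoc, Finset.mul_sum]
  have hshift : ∀ s ∈ S, ∑ x ∈ A, f x * (u (x * s) ^ 2 / f (x * s)) ≤
      ∑ y ∈ B, f (y * s⁻¹) * (u y ^ 2 / f y) := by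
    intro s hs
    calc ∑ x ∈ A, f x * (u (x * s) ^ 2 / f (x * s))
        = ∑ y ∈ A.image (· * s), f (y * s⁻¹) * (u y ^ 2 / f y) := by
          rw [Finset.sum_image fun x _ y _ h => mul_right_cancel h]
          simp
      _ ≤ _ := by
          refine Finset.sum_le_sum_of_subset_of_nonneg ?_ fun y _ _ => hnn _ _
          intro y hy
          obtain ⟨x, hx, rfl⟩ := Finset.mem_image.1 hy
          exact Finset.mem_image.2 ⟨(x, s), Finset.mem_product.2 ⟨hx, hs⟩, rfl⟩
  have hinv : ∀ y, ∑ s ∈ S, f (y * s⁻¹) = ∑ s ∈ S, f (y * s) := fun y =>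
    Finset.sum_nbij' (fun s => s⁻¹) (fun s => s⁻¹) hS hS (by simp) (by simp) (by simp)
  calc ∑ x ∈ A, (∑ s ∈ S, u (x * s)) ^ 2
      ≤ ∑ x ∈ A, C * ∑ s ∈ S, f x * (u (x * s) ^ 2 / f (x * s)) :=
        Finset.sum_le_sum fun x _ => hpt x
    _ = C * ∑ s ∈ S, ∑ x ∈ A, f x * (u (x * s) ^ 2 / f (x * s)) := by
        rw [← Finset.mul_sum, Finset.sum_comm]
    _ ≤ C * ∑ s ∈ S, ∑ y ∈ B, f (y * s⁻¹) * (u y ^ 2 / f y) :=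
        mul_le_mul_of_nonneg_left (Finset.sum_le_sum hshift) hC
    _ = C * ∑ y ∈ B, (∑ s ∈ S, f (y * s)) * (u y ^ 2 / f y) := by
        rw [Finset.sum_comm]
        simp_rw [← Finset.sum_mul, hinv]
    _ ≤ C * ∑ y ∈ B, C * u y ^ 2 := by
        refine mul_le_mul_of_nonneg_left (Finset.sum_le_sum fun y _ => ?_) hC
        calc (∑ s ∈ S, f (y * s)) * (u y ^ 2 / f y)
            ≤ (C * f y) * (u y ^ 2 / f y) :=
              mul_le_mul_of_nonneg_right (hfS y) (div_nonneg (sq_nonneg _) (hf y).le)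
          _ = C * u y ^ 2 := by have := (hf y).ne'; field_simp
    _ = C ^ 2 * ∑ y ∈ B, u y ^ 2 := by rw [← Finset.mul_sum]; ring

theorem inv_mem_Sgen {g : ℕ} {s : SurfaceGroup g} (hs : s ∈ Sgen g) : s⁻¹ ∈ Sgen g := by
  classical
  simp only [Sgen, Finset.mem_image, Finset.mem_univ, true_and] at hs ⊢
  obtain ⟨⟨j, w, i⟩, rfl⟩ := hs
  refine ⟨(j, w, !i), ?_⟩
  cases i <;> simp [sgenFun]

theorem IsMarkov.norm_le_s2 {g : ℕ}
    {M : lp (fun _ : SurfaceGroup g => ℂ) 2 →L[ℂ] lp (fun _ : SurfaceGroup g => ℂ) 2}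
    (hM : IsMarkov g M) (f : SurfaceGroup g → ℝ) (hf : ∀ x, 0 < f x) {C : ℝ} (hC : 0 ≤ C)
    (hfS : ∀ x, ∑ s ∈ Sgen g, f (x * s) ≤ C * f x) :
    ‖M‖ ≤ (4 * (g : ℝ))⁻¹ * C := by
  have hK : 0 ≤ (4 * (g : ℝ))⁻¹ * C := by positivity
  refine M.opNorm_le_bound hK fun v => ?_
  have h2 : (0 : ℝ) < (2 : ENNReal).toReal := by norm_num
  refine lp.norm_le_of_forall_sum_le h2 (by positivity) fun A => ?_
  obtain ⟨B, hB⟩ := sum_sq_sum_mul_right_le_s2 (Sgen g) (fun _ => inv_mem_Sgen) f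
    (fun x => ‖v x‖) hf hC hfS A
  have hv := lp.sum_rpow_le_norm_rpow h2 v B
  simp only [ENNReal.toReal_ofNat, Real.rpow_ofNat] at hv ⊢
  have hpt : ∀ x, ‖M v x‖ ^ 2 ≤
      ((4 * (g : ℝ))⁻¹) ^ 2 * (∑ s ∈ Sgen g, ‖v (x * s)‖) ^ 2 := by
    intro x
    rw [hM v x, norm_mul, mul_pow]
    have : ‖(4 * (g : ℂ))⁻¹‖ = (4 * (g : ℝ))⁻¹ := by simp
    rw [this]
    gcongr
    exact norm_sum_le _ _
  calc ∑ x ∈ A, ‖M v x‖ ^ 2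
      ≤ ∑ x ∈ A, ((4 * (g : ℝ))⁻¹) ^ 2 * (∑ s ∈ Sgen g, ‖v (x * s)‖) ^ 2 :=
        Finset.sum_le_sum fun x _ => hpt x
    _ = ((4 * (g : ℝ))⁻¹) ^ 2 * ∑ x ∈ A, (∑ s ∈ Sgen g, ‖v (x * s)‖) ^ 2 := by
        rw [Finset.mul_sum]
    _ ≤ ((4 * (g : ℝ))⁻¹) ^ 2 * (C ^ 2 * ∑ y ∈ B, ‖v y‖ ^ 2) := by gcongr
    _ ≤ ((4 * (g : ℝ))⁻¹) ^ 2 * (C ^ 2 * ‖v‖ ^ 2) := by gcongr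
    _ = ((4 * (g : ℝ))⁻¹ * C * ‖v‖) ^ 2 := by ring

/-! ### Rotations and translations in `SL(2, ℝ)` -/

/-- The lift to `SL(2, ℝ)` of the rotation of the hyperbolic plane by the angle `α` about the
base point. -/
def hypRot (α : ℝ) : Matrix.SpecialLinearGroup (Fin 2) ℝ :=
  ⟨!![Real.cos (α / 2), -Real.sin (α / 2); Real.sin (α / 2), Real.cos (α / 2)], by
    rw [Matrix.det_fin_two_of]
    linear_combination Real.cos_sq_add_sin_sq (α / 2)⟩

/-- The lift to `SL(2, ℝ)` of the translation of the hyperbolic plane by the distance `t` along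
a fixed geodesic through the base point. -/
def hypTrans (t : ℝ) : Matrix.SpecialLinearGroup (Fin 2) ℝ :=
  ⟨!![Real.exp (t / 2), 0; 0, Real.exp (-(t / 2))], by
    rw [Matrix.det_fin_two_of, ← Real.exp_add]
    simp⟩

theorem coe_hypRot (α : ℝ) : (hypRot α : Matrix (Fin 2) (Fin 2) ℝ) =
    !![Real.cos (α / 2), -Real.sin (α / 2); Real.sin (α / 2), Real.cos (α / 2)] := rfl

theorem coe_hypTrans (t : ℝ) : (hypTrans t : Matrix (Fin 2) (Fin 2) ℝ) =
    !![Real.exp (t / 2), 0; 0, Real.exp (-(t / 2))] := rfl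

theorem hypRot_mul (α β : ℝ) : hypRot α * hypRot β = hypRot (α + β) := by
  ext i j
  fin_cases i <;> fin_cases j <;>
    simp [coe_hypRot, add_div, Real.cos_add, Real.sin_add] <;> ring

theorem hypRot_zero : hypRot 0 = 1 := by
  ext i j
  fin_cases i <;> fin_cases j <;> simp [coe_hypRot]

theorem hypRot_inv (α : ℝ) : (hypRot α)⁻¹ = hypRot (-α) := by
  rw [inv_eq_iff_mul_eq_one, hypRot_mul, add_neg_cancel, hypRot_zero]

theorem hypRot_sub_two_pi (α : ℝ) : hypRot (α - 2 * π) = -hypRot α := by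
  have h : (α - 2 * π) / 2 = α / 2 - π := by ring
  ext i j
  fin_cases i <;> fin_cases j <;> simp [coe_hypRot, h, Real.cos_sub_pi, Real.sin_sub_pi]

theorem hypTrans_inv (t : ℝ) : (hypTrans t)⁻¹ = hypRot π * hypTrans t * hypRot (-π) := by
  rw [inv_eq_iff_mul_eq_one]
  ext i j
  fin_cases i <;> fin_cases j <;>
    simp [coe_hypRot, coe_hypTrans, neg_div, ← Real.exp_add]

/-- Powers of a unimodular `2 × 2` matrix with trace `2 cos t`. -/
theorem Matrix.SpecialLinearGroup.sin_smul_pow (W : Matrix.SpecialLinearGroup (Fin 2) ℝ) {t : ℝ}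
    (ht : W.1 0 0 + W.1 1 1 = 2 * Real.cos t) (n : ℕ) :
    Real.sin t • W.1 ^ (n + 1) = Real.sin ((n + 1) * t) • W.1 - Real.sin (n * t) • 1 := by
  have hsq : W.1 ^ 2 = (2 * Real.cos t) • W.1 - 1 := by
    have hdet := W.2
    rw [Matrix.det_fin_two] at hdet
    rw [← ht, pow_two]
    ext i j
    fin_cases i <;> fin_cases j <;> simp [Matrix.mul_apply, Fin.sum_univ_two]
    · linear_combination -hdet
    · ring
    · ring
    · linear_combination -hdet
  induction n with
  | zero => simp
  | succ n ih =>
    rw [pow_succ, ← smul_mul_assoc, ih, sub_mul, smul_mul_assoc, smul_mul_assoc, one_mul,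
      ← pow_two, hsq, smul_sub, smul_smul]
    have h1 : Real.sin ((((n + 1 : ℕ) : ℝ) + 1) * t) =
        Real.sin ((n + 1) * t) * (2 * Real.cos t) - Real.sin (n * t) := by
      have e1 : (((n + 1 : ℕ) : ℝ) + 1) * t = (n + 1) * t + t := by push_cast; ring
      have e2 : (n : ℝ) * t = (n + 1) * t - t := by ring
      rw [e1, e2, Real.sin_add, Real.sin_sub]
      ring
    rw [h1, sub_smul]
    push_cast
    abel

/-! ### The uniformising representation of the surface group -/

theorem cosh_Dg_half {g : ℕ} (hg : 2 ≤ g) :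
    Real.cosh (Dg g / 2) * Real.sin (π / (4 * g)) = Real.cos (π / (4 * g)) := by
  have hg' : (2 : ℝ) ≤ g := by exact_mod_cast hg
  have hpos : 0 < π / (4 * g) := by positivity
  have hle : π / (4 * g) ≤ π / 4 := by
    apply div_le_div_of_nonneg_left Real.pi_pos.le <;> linarith
  have hpi := Real.pi_pos
  have hsin : 0 < Real.sin (π / (4 * g)) := Real.sin_pos_of_pos_of_lt_pi hpos (by linarith)
  have htan : 0 < Real.tan (π / (4 * g)) := Real.tan_pos_of_pos_of_lt_pi_div_two hpos (by linarith)
  have htan1 : Real.tan (π / (4 * g)) ≤ 1 := by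
    rw [← Real.tan_pi_div_four]
    exact Real.strictMonoOn_tan.monotoneOn ⟨by linarith, by linarith⟩ ⟨by linarith, by linarith⟩ hle
  have h : Real.cosh (Dg g / 2) = (Real.tan (π / (4 * g)))⁻¹ := by
    have : Dg g / 2 = Real.arcosh (Real.tan (π / (4 * g)))⁻¹ := by
      rw [Dg, mul_div_cancel_left₀ _ two_ne_zero, arcosh, Real.arcosh]
    rw [this, Real.cosh_arcosh (one_le_inv₀ htan |>.2 htan1)]
  rw [h, Real.tan_eq_sin_div_cos, inv_div, div_mul_cancel₀ _ hsin.ne']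

/-- The angle between consecutive edges of the regular `4g`-gon tessellation `{4g, 4g}`. -/
def tessAngle (g : ℕ) : ℝ := 2 * π / (4 * g)

/-- The rotation about the centre of a `4g`-gon, moving each vertex to the next one. -/
def polyRot (g : ℕ) : Matrix.SpecialLinearGroup (Fin 2) ℝ :=
  hypTrans (Dg g) * hypRot (π + tessAngle g)

theorem polyRot_pow {g : ℕ} (hg : 2 ≤ g) : polyRot g ^ (4 * g) = -1 := by
  have hg' : (2 : ℝ) ≤ g := by exact_mod_cast hg
  have hpi := Real.pi_pos
  have hpos : 0 < π / (4 * g) := by positivity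
  have hlt : π / (4 * g) < π := by
    rw [div_lt_iff₀ (by positivity)]; nlinarith
  have hsin : 0 < Real.sin (π / (4 * g)) := Real.sin_pos_of_pos_of_lt_pi hpos hlt
  have htr : (-polyRot g).1 0 0 + (-polyRot g).1 1 1 = 2 * Real.cos (π / (4 * g)) := by
    have h : (π + tessAngle g) / 2 = π / (4 * g) + π / 2 := by
      rw [tessAngle]; ring
    rw [← cosh_Dg_half hg, Real.cosh_eq]
    simp [polyRot, coe_hypTrans, coe_hypRot, h, Real.cos_add_pi_div_two]
    ring
  obtain ⟨n, hn⟩ : ∃ n, 4 * g = n + 1 := ⟨4 * g - 1, by omega⟩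
  have key := Matrix.SpecialLinearGroup.sin_smul_pow (-polyRot g) htr n
  have hnR : (4 * g : ℝ) = n + 1 := by exact_mod_cast hn
  have e1 : ((n : ℝ) + 1) * (π / (4 * g)) = π := by rw [← hnR]; field_simp
  have e2 : (n : ℝ) * (π / (4 * g)) = π - π / (4 * g) := by linear_combination e1
  rw [e1, e2, Real.sin_pi, Real.sin_pi_sub, ← hn, zero_smul, zero_sub, ← smul_neg] at key
  have hneg : (-polyRot g) ^ (4 * g) = polyRot g ^ (4 * g) :=
    Even.neg_pow ⟨2 * g, by ring⟩ _
  rw [← hneg]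
  apply Subtype.ext
  simpa using smul_right_injective _ hsin.ne' key

/-- The images of the generators `a_j` and `b_j` in `SL(2, ℝ)`. -/
def genMat (g : ℕ) (j : ℕ) (w : Bool) : Matrix.SpecialLinearGroup (Fin 2) ℝ :=
  if w then
    hypRot ((4 * j + 3) * tessAngle g) * hypTrans (Dg g) * hypRot (π - (4 * j + 1) * tessAngle g)
  else
    hypRot (4 * j * tessAngle g) * hypTrans (Dg g) * hypRot (π - (4 * j + 2) * tessAngle g)

theorem genMat_commutator (g j : ℕ) :
    genMat g j false * genMat g j true * (genMat g j false)⁻¹ * (genMat g j true)⁻¹ =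
      hypRot (4 * j * tessAngle g) * polyRot g ^ 4 * hypRot (-(4 * (j + 1) * tessAngle g)) := by
  generalize hδ : tessAngle g = δ
  have hm : ∀ α β x, hypRot α * (hypRot β * x) = hypRot (α + β) * x := fun α β x => by
    rw [← mul_assoc, hypRot_mul]
  have e2 : π - (4 * j + 2) * δ + (4 * j + 3) * δ = π + δ := by ring
  have e3 : π - (4 * j + 1) * δ + (-(π - (4 * j + 2) * δ) + π) = π + δ := by ring
  have e4 : -π + -(4 * (j * δ)) + (-(π - (4 * j + 1) * δ) + π) = π + δ - 2 * π := by ring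
  have e5 : -π + -((4 * j + 3) * δ) = π + δ + -(4 * ((j + 1) * δ)) - 2 * π := by ring
  simp only [genMat, polyRot, hδ, pow_succ, pow_zero, one_mul, mul_inv_rev, hypRot_inv,
    hypTrans_inv, mul_assoc, hm, hypRot_mul, if_true, Bool.false_eq_true, if_false]
  rw [e2, e3, e4, e5, hypRot_sub_two_pi, hypRot_sub_two_pi]
  simp only [mul_neg, neg_mul, neg_neg]

theorem prod_genMat_commutator (g n : ℕ) :
    ((List.range n).map fun j =>
      genMat g j false * genMat g j true * (genMat g j false)⁻¹ * (genMat g j true)⁻¹).prod =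
      polyRot g ^ (4 * n) * hypRot (-(4 * n * tessAngle g)) := by
  induction n with
  | zero => simp [hypRot_zero]
  | succ n ih =>
    rw [List.range_succ, List.map_append, List.prod_append, ih, List.map_singleton,
      List.prod_singleton, genMat_commutator]
    have h : hypRot (-(4 * n * tessAngle g)) * hypRot (4 * n * tessAngle g) = 1 := by
      rw [hypRot_mul, neg_add_cancel, hypRot_zero]
    rw [mul_assoc (hypRot _), mul_assoc, ← mul_assoc (hypRot _), h, one_mul, ← mul_assoc,
      ← pow_add, Nat.cast_add_one, mul_add_one 4 n]

theorem lift_genMat_surfaceRel {g : ℕ} (hg : 2 ≤ g) :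
    FreeGroup.lift (fun p : Fin g × Bool => genMat g p.1 p.2) (surfaceRel g) = 1 := by
  have h : FreeGroup.lift (fun p : Fin g × Bool => genMat g p.1 p.2) (surfaceRel g) =
      polyRot g ^ (4 * g) * hypRot (-(4 * g * tessAngle g)) := by
    rw [← prod_genMat_commutator, ← List.map_coe_finRange_eq_range, surfaceRel, map_list_prod,
      List.map_map, List.map_map]
    congr 1
    simp [Function.comp_def]
  have hg' : (g : ℝ) ≠ 0 := by positivity
  have e : -(4 * g * tessAngle g) = 0 - 2 * π := by rw [tessAngle]; field_simp; ring
  rw [h, polyRot_pow hg, e, hypRot_sub_two_pi, hypRot_zero]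
  simp

/-- The holonomy representation of the surface group. -/
def holonomy {g : ℕ} (hg : 2 ≤ g) : SurfaceGroup g →* Matrix.SpecialLinearGroup (Fin 2) ℝ :=
  PresentedGroup.toGroup (f := fun p : Fin g × Bool => genMat g p.1 p.2) (by
    rintro r rfl
    exact lift_genMat_surfaceRel hg)

theorem holonomy_of {g : ℕ} (hg : 2 ≤ g) (j : Fin g) (w : Bool) :
    holonomy hg (PresentedGroup.of (j, w)) = genMat g j w :=
  PresentedGroup.toGroup.of _

/-- The position of a generator in the cyclic order of the edges issuing from a vertex. -/
def edgeIndex : Bool → Bool → ℕ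
  | false, false => 0
  | true, true => 1
  | false, true => 2
  | true, false => 3

theorem holonomy_sgenFun {g : ℕ} (hg : 2 ≤ g) (j : Fin g) (w i : Bool) :
    ∃ η, holonomy hg (sgenFun g (j, w, i)) =
      hypRot ((4 * j + edgeIndex w i : ℕ) * tessAngle g) * hypTrans (Dg g) * hypRot η ∨
      holonomy hg (sgenFun g (j, w, i)) =
      -(hypRot ((4 * j + edgeIndex w i : ℕ) * tessAngle g) * hypTrans (Dg g) * hypRot η) := by
  set δ := tessAngle g
  have hinv : ∀ α β, (hypRot α * hypTrans (Dg g) * hypRot (π - β))⁻¹ =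
      -(hypRot β * hypTrans (Dg g) * hypRot (π - α)) := by
    intro α β
    have e1 : -(π - β) + π = β := by ring
    have e2 : -π + -α = π - α - 2 * π := by ring
    rw [mul_inv_rev, mul_inv_rev, hypRot_inv, hypRot_inv, hypTrans_inv, mul_assoc (_ * _),
      hypRot_mul, e2, hypRot_sub_two_pi, ← mul_assoc, ← mul_assoc, hypRot_mul, e1, mul_neg]
  cases w <;> cases i <;>
    simp only [sgenFun, if_true, Bool.false_eq_true, if_false, map_inv, holonomy_of, genMat, hinv,
      edgeIndex]
  · exact ⟨_, Or.inl (by push_cast; rw [add_zero])⟩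
  · exact ⟨_, Or.inr (by push_cast; rfl)⟩
  · exact ⟨_, Or.inl (by push_cast; rfl)⟩
  · exact ⟨_, Or.inr (by push_cast; rfl)⟩

/-! ### The Poisson kernel along the orbit -/

/-- The reciprocal of the Poisson kernel at the image of the base point. -/
def rowSq (A : Matrix.SpecialLinearGroup (Fin 2) ℝ) : ℝ := A.1 0 0 ^ 2 + A.1 0 1 ^ 2

theorem rowSq_pos (A : Matrix.SpecialLinearGroup (Fin 2) ℝ) : 0 < rowSq A := by
  have hdet := A.2
  rw [Matrix.det_fin_two] at hdet
  rw [rowSq]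
  by_contra h
  have h0 : A.1 0 0 = 0 := by nlinarith [sq_nonneg (A.1 0 0), sq_nonneg (A.1 0 1)]
  have h1 : A.1 0 1 = 0 := by nlinarith [sq_nonneg (A.1 0 0), sq_nonneg (A.1 0 1)]
  rw [h0, h1] at hdet
  simp at hdet

theorem rowSq_neg (A : Matrix.SpecialLinearGroup (Fin 2) ℝ) : rowSq (-A) = rowSq A := by
  simp [rowSq]

theorem rowSq_mul_hypRot (A : Matrix.SpecialLinearGroup (Fin 2) ℝ) (η : ℝ) :
    rowSq (A * hypRot η) = rowSq A := by
  simp [rowSq, coe_hypRot, Matrix.mul_apply, Fin.sum_univ_two]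
  linear_combination (A.1 0 0 ^ 2 + A.1 0 1 ^ 2) * Real.cos_sq_add_sin_sq (η / 2)

theorem exists_rowSq_mul (A : Matrix.SpecialLinearGroup (Fin 2) ℝ) :
    ∃ φ, ∀ θ t, rowSq (A * (hypRot θ * hypTrans t)) =
      rowSq A * (Real.cosh t - Real.sinh t * Real.cos (φ + θ)) := by
  obtain ⟨r, β, hx, hy⟩ : ∃ r β, A.1 0 0 = r * Real.cos β ∧ A.1 0 1 = r * Real.sin β := by
    set z : ℂ := ⟨A.1 0 0, A.1 0 1⟩
    exact ⟨‖z‖, z.arg, (Complex.norm_mul_cos_arg z).symm, (Complex.norm_mul_sin_arg z).symm⟩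
  refine ⟨π - 2 * β, fun θ t => ?_⟩
  have hsq := Real.cos_sq_add_sin_sq β
  have hcos : Real.cos (π - 2 * β + θ) = 1 - 2 * Real.cos (β - θ / 2) ^ 2 := by
    have e : π - 2 * β + θ = π - 2 * (β - θ / 2) := by ring
    rw [e, Real.cos_pi_sub, Real.cos_two_mul]
    ring
  have hr : rowSq A = r ^ 2 := by
    rw [rowSq, hx, hy]
    linear_combination r ^ 2 * hsq
  have h0 : (A * (hypRot θ * hypTrans t)).1 0 0 =
      r * Real.cos (β - θ / 2) * Real.exp (t / 2) := by
    rw [Real.cos_sub]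
    simp [coe_hypRot, coe_hypTrans, Matrix.mul_apply, Fin.sum_univ_two, hx, hy]
    ring
  have h1 : (A * (hypRot θ * hypTrans t)).1 0 1 =
      r * Real.sin (β - θ / 2) * Real.exp (-(t / 2)) := by
    rw [Real.sin_sub]
    simp [coe_hypRot, coe_hypTrans, Matrix.mul_apply, Fin.sum_univ_two, hx, hy]
    ring
  have ht : Real.exp (t / 2) ^ 2 = Real.exp t := by
    rw [← Real.exp_nat_mul]; congr 1; push_cast; ring
  have ht' : Real.exp (-(t / 2)) ^ 2 = Real.exp (-t) := by
    rw [← Real.exp_nat_mul]; congr 1; push_cast; ring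
  rw [hr, hcos, rowSq, h0, h1, mul_pow, mul_pow, mul_pow, mul_pow, ht, ht', Real.sin_sq,
    Real.cosh_eq, Real.sinh_eq]
  ring

theorem bker_denom_pos (t φ : ℝ) : 0 < Real.cosh t - Real.sinh t * Real.cos φ := by
  have h1 := Real.cos_le_one φ
  have h2 := Real.neg_one_le_cos φ
  rw [Real.cosh_eq, Real.sinh_eq]
  nlinarith [mul_nonneg (Real.exp_pos t).le (sub_nonneg.2 h1),
    mul_nonneg (Real.exp_pos (-t)).le (sub_nonneg.2 h2), Real.exp_pos t, Real.exp_pos (-t)]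

theorem Fg_le_sSup (g : ℕ) (ν φ : ℝ) : Fg g ν φ ≤ sSup (Fg g ν '' Set.Icc 0 (2 * π)) := by
  have hcont : Continuous (Fg g ν) := by
    unfold Fg
    refine continuous_const.mul (continuous_finsetSum _ fun j _ => ?_)
    unfold bker
    refine Continuous.rpow_const (Continuous.inv₀ (by fun_prop) fun φ => (bker_denom_pos _ _).ne')
      fun φ => Or.inl (inv_pos.2 (bker_denom_pos _ _)).ne'
  have hper : Function.Periodic (Fg g ν) (2 * π) := by
    intro φ
    have : ∀ x : ℝ, bker (Dg g) (φ + 2 * π + x) = bker (Dg g) (φ + x) := fun x => by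
      rw [bker, bker, add_right_comm, Real.cos_add_two_pi]
    simp only [Fg, this]
  obtain ⟨ψ, hψ, h⟩ := hper.exists_mem_Ico₀ Real.two_pi_pos φ
  rw [h]
  exact le_csSup (isCompact_Icc.image hcont).bddAbove ⟨ψ, Set.Ico_subset_Icc_self hψ, rfl⟩

theorem sum_edgeIndex (c : ℕ → ℝ) (g : ℕ) :
    ∑ p : Fin g × Bool × Bool, c (4 * p.1 + edgeIndex p.2.1 p.2.2) =
      ∑ j ∈ Finset.range (4 * g), c j := by
  rw [Fintype.sum_prod_type, Fin.sum_univ_eq_sum_range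
    (fun j => ∑ q : Bool × Bool, c (4 * j + edgeIndex q.1 q.2))]
  induction g with
  | zero => simp
  | succ n ih =>
    rw [Finset.sum_range_succ, ih, mul_add, mul_one, Finset.sum_range_add]
    simp [Fintype.sum_prod_type, edgeIndex, Finset.sum_range_succ]
    ring

open scoped Classical in
theorem sum_Sgen_le (g : ℕ) (f : SurfaceGroup g → ℝ) (hf : ∀ x, 0 ≤ f x) :
    ∑ s ∈ Sgen g, f s ≤ ∑ p : Fin g × Bool × Bool, f (sgenFun g p) :=
  Finset.sum_image_le_of_nonneg fun _ _ => hf _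

/-- Lemma 1: for every `g ≥ 2` and every real `ν`,
`μ_g ≤ sup_{0 ≤ φ ≤ 2π} F_g(ν, φ)`. -/
theorem mu_le_sup_Fg (g : ℕ) (hg : 2 ≤ g) (ν : ℝ)
    (M : lp (fun _ : SurfaceGroup g => ℂ) 2 →L[ℂ] lp (fun _ : SurfaceGroup g => ℂ) 2)
    (hM : IsMarkov g M) :
    ‖M‖ ≤ sSup (Fg g ν '' Set.Icc 0 (2 * π)) := by
  set Λ := sSup (Fg g ν '' Set.Icc 0 (2 * π))
  have hg0 : (0 : ℝ) < 4 * g := by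
    have : 0 < g := by omega
    positivity
  have hΛ : 0 ≤ Λ := by
    refine le_trans ?_ (Fg_le_sSup g ν 0)
    exact mul_nonneg (inv_nonneg.2 hg0.le) (Finset.sum_nonneg fun j _ =>
      Real.rpow_nonneg (inv_nonneg.2 (bker_denom_pos _ _).le) _)
  set h : SurfaceGroup g → ℝ := fun x => rowSq (holonomy hg x)
  have hpos : ∀ x, 0 < h x := fun x => rowSq_pos _
  have hfpos : ∀ x, 0 < h x ^ (-ν) := fun x => Real.rpow_pos_of_pos (hpos x) _
  have key := hM.norm_le_s2 (fun x => h x ^ (-ν)) hfpos (C := 4 * g * Λ) (by positivity) fun x => by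
    obtain ⟨φ, hφ⟩ := exists_rowSq_mul (holonomy hg x)
    have hgen : ∀ p : Fin g × Bool × Bool, h (x * sgenFun g p) ^ (-ν) = h x ^ (-ν) *
        bker (Dg g) (φ + (4 * p.1 + edgeIndex p.2.1 p.2.2 : ℕ) * (2 * π / (4 * g))) ^ ν := by
      rintro ⟨j, w, i⟩
      obtain ⟨η, hη⟩ := holonomy_sgenFun hg j w i
      have : h (x * sgenFun g (j, w, i)) = h x * (Real.cosh (Dg g) - Real.sinh (Dg g) *
          Real.cos (φ + (4 * j + edgeIndex w i : ℕ) * tessAngle g)) := by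
        rw [← hφ]
        simp only [h, map_mul]
        rcases hη with hη | hη <;> rw [hη]
        · rw [← mul_assoc, rowSq_mul_hypRot]
        · rw [mul_neg, rowSq_neg, ← mul_assoc, rowSq_mul_hypRot]
      rw [this, Real.mul_rpow (hpos x).le (bker_denom_pos _ _).le, bker,
        Real.inv_rpow (bker_denom_pos _ _).le, Real.rpow_neg (bker_denom_pos _ _).le, tessAngle]
    calc ∑ s ∈ Sgen g, h (x * s) ^ (-ν)
        ≤ ∑ p : Fin g × Bool × Bool, h (x * sgenFun g p) ^ (-ν) :=
          sum_Sgen_le g (fun s => h (x * s) ^ (-ν)) fun s => (hfpos _).le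
      _ = h x ^ (-ν) * (4 * g * Fg g ν φ) := by
          simp_rw [hgen]
          rw [← Finset.mul_sum, sum_edgeIndex
            (fun n => bker (Dg g) (φ + n * (2 * π / (4 * g))) ^ ν), Fg,
            mul_inv_cancel_left₀ hg0.ne']
      _ ≤ h x ^ (-ν) * (4 * g * Λ) := by
          have := Fg_le_sSup g ν φ
          have := (hfpos x).le
          gcongr
      _ = 4 * g * Λ * h x ^ (-ν) := mul_comm _ _
  rwa [inv_mul_cancel_left₀ hg0.ne'] at key
end
end

section
/- Suppose there exist a positive 1-form ω on X and a constant c > 0 such that for every vertex x of X one has (1/k) · Σ_{y ∼ x} ω(y,x) ≤ c (the sum being over all neighbours y of x). Then μ(X) ≤ c. -/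
noncomputable section

/-- `M` is the Markov operator on `ℓ²(X⁰)` of the simple random walk on the
locally finite `k`-regular graph `G`: `(M f)(x) = (1/k) ∑_{y ∼ x} f(y)`;
`μ(X)` is by definition its operator norm `‖M‖`. -/
def IsGraphMarkov {V : Type*} (G : SimpleGraph V) [∀ v, Fintype (G.neighborSet v)] (k : ℕ)
    (M : lp (fun _ : V => ℂ) 2 →L[ℂ] lp (fun _ : V => ℂ) 2) : Prop :=
  ∀ (f : lp (fun _ : V => ℂ) 2) (x : V),
    M f x = (k : ℂ)⁻¹ * ∑ y ∈ G.neighborFinset x, f y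

open Finset in
/-- Weighted Cauchy–Schwarz inequality for averages over the neighbours of a vertex. -/
lemma norm_sq_average_le {V : Type*} (s : Finset V) (k : ℕ) (f : V → ℂ) (u w : V → ℝ)
    (hu : ∀ y ∈ s, 0 ≤ u y) (hw : ∀ y ∈ s, 0 ≤ w y) (huw : ∀ y ∈ s, u y * w y = 1)
    (c : ℝ) (hc : (k : ℝ)⁻¹ * ∑ y ∈ s, u y ≤ c) :
    ‖(k : ℂ)⁻¹ * ∑ y ∈ s, f y‖ ^ 2 ≤ c * ((k : ℝ)⁻¹ * ∑ y ∈ s, w y * ‖f y‖ ^ 2) := by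
  have hwf : ∀ y ∈ s, 0 ≤ w y * ‖f y‖ ^ 2 := fun y hy => mul_nonneg (hw y hy) (sq_nonneg _)
  have hcs : (∑ y ∈ s, ‖f y‖) ^ 2 ≤ (∑ y ∈ s, u y) * ∑ y ∈ s, w y * ‖f y‖ ^ 2 :=
    sum_sq_le_sum_mul_sum_of_sq_le_mul s hu hwf fun y hy => by
      rw [← mul_assoc, huw y hy, one_mul]
  calc ‖(k : ℂ)⁻¹ * ∑ y ∈ s, f y‖ ^ 2
      = (k : ℝ)⁻¹ ^ 2 * ‖∑ y ∈ s, f y‖ ^ 2 := by simp [mul_pow]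
    _ ≤ (k : ℝ)⁻¹ ^ 2 * ((∑ y ∈ s, u y) * ∑ y ∈ s, w y * ‖f y‖ ^ 2) := by
        gcongr
        exact (pow_le_pow_left₀ (norm_nonneg _) (norm_sum_le _ _) 2).trans hcs
    _ = ((k : ℝ)⁻¹ * ∑ y ∈ s, u y) * ((k : ℝ)⁻¹ * ∑ y ∈ s, w y * ‖f y‖ ^ 2) := by ring
    _ ≤ c * ((k : ℝ)⁻¹ * ∑ y ∈ s, w y * ‖f y‖ ^ 2) :=
        mul_le_mul_of_nonneg_right hc
          (mul_nonneg (by positivity) (sum_nonneg hwf))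

open Finset in
/-- A finite partial sum over directed edges is bounded by the sum with the edges grouped by
their end points. -/
lemma exists_sum_neighborFinset_le {V : Type*} (G : SimpleGraph V)
    [∀ v, Fintype (G.neighborSet v)] (s : Finset V) (g : V → V → ℝ)
    (hg : ∀ x y, G.Adj x y → 0 ≤ g x y) :
    ∃ t : Finset V, ∑ x ∈ s, ∑ y ∈ G.neighborFinset x, g x y ≤
      ∑ y ∈ t, ∑ x ∈ G.neighborFinset y, g x y := by
  classical
  refine ⟨s.biUnion fun x => G.neighborFinset x, ?_⟩
  rw [sum_comm' (t' := s.biUnion fun x => G.neighborFinset x)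
    (s' := fun y => {x ∈ G.neighborFinset y | x ∈ s})]
  · refine sum_le_sum fun y _ => sum_le_sum_of_subset_of_nonneg (filter_subset _ _) ?_
    intro x hx _
    exact hg x y ((G.mem_neighborFinset y x).1 hx).symm
  · intro x y
    simp only [SimpleGraph.mem_neighborFinset, mem_filter, mem_biUnion]
    constructor
    · rintro ⟨hx, hxy⟩
      exact ⟨⟨hxy.symm, hx⟩, x, hx, hxy⟩
    · rintro ⟨⟨hyx, hx⟩, -⟩
      exact ⟨hx, hyx.symm⟩

/-- Proposition 1 (O. Gabber): if a `k`-regular connected graph `X` carries a positive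
`1`-form `ω` (i.e. `ω(x,y) > 0` and `ω(y,x) = ω(x,y)⁻¹` for adjacent `x, y`) and a
constant `c > 0` with `(1/k) ∑_{y ∼ x} ω(y,x) ≤ c` for all vertices `x`, then
`μ(X) ≤ c`. -/
theorem gabber_bound {V : Type*} (G : SimpleGraph V) [∀ v, Fintype (G.neighborSet v)]
    (hconn : G.Connected) (k : ℕ) (hreg : G.IsRegularOfDegree k)
    (M : lp (fun _ : V => ℂ) 2 →L[ℂ] lp (fun _ : V => ℂ) 2)
    (hM : IsGraphMarkov G k M)
    (ω : V → V → ℝ)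
    (hpos : ∀ x y, G.Adj x y → 0 < ω x y)
    (hsym : ∀ x y, G.Adj x y → ω y x = (ω x y)⁻¹)
    (c : ℝ) (hc : 0 < c)
    (hbound : ∀ x : V, (k : ℝ)⁻¹ * ∑ y ∈ G.neighborFinset x, ω y x ≤ c) :
    ‖M‖ ≤ c := by
  refine M.opNorm_le_bound hc.le fun f => ?_
  refine lp.norm_le_of_forall_sum_le (by norm_num) (by positivity) fun s => ?_
  obtain ⟨t, ht⟩ := exists_sum_neighborFinset_le G s (fun x y => ω x y * ‖f y‖ ^ 2)
    fun x y h => mul_nonneg (hpos x y h).le (sq_nonneg _)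
  have hf : ∑ y ∈ t, ‖f y‖ ^ 2 ≤ ‖f‖ ^ 2 := by
    simpa using lp.sum_rpow_le_norm_rpow (by norm_num) f t
  have hx : ∀ x, ‖M f x‖ ^ 2 ≤
      c * ((k : ℝ)⁻¹ * ∑ y ∈ G.neighborFinset x, ω x y * ‖f y‖ ^ 2) := by
    intro x
    rw [hM f x]
    refine norm_sq_average_le _ k f (fun y => ω y x) (ω x) ?_ ?_ ?_ c (hbound x) <;>
      intro y hy <;> rw [SimpleGraph.mem_neighborFinset] at hy
    · exact (hpos y x hy.symm).le
    · exact (hpos x y hy).le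
    · rw [hsym x y hy]
      exact inv_mul_cancel₀ (hpos x y hy).ne'
  have key : ∑ x ∈ s, ‖M f x‖ ^ 2 ≤ (c * ‖f‖) ^ 2 :=
    calc ∑ x ∈ s, ‖M f x‖ ^ 2
        ≤ ∑ x ∈ s, c * ((k : ℝ)⁻¹ * ∑ y ∈ G.neighborFinset x, ω x y * ‖f y‖ ^ 2) :=
          Finset.sum_le_sum fun x _ => hx x
      _ = c * ((k : ℝ)⁻¹ * ∑ x ∈ s, ∑ y ∈ G.neighborFinset x, ω x y * ‖f y‖ ^ 2) := by
          simp only [Finset.mul_sum]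
      _ ≤ c * ((k : ℝ)⁻¹ * ∑ y ∈ t, ∑ x ∈ G.neighborFinset y, ω x y * ‖f y‖ ^ 2) := by
          gcongr
      _ = c * ∑ y ∈ t, ((k : ℝ)⁻¹ * ∑ x ∈ G.neighborFinset y, ω x y) * ‖f y‖ ^ 2 := by
          simp only [Finset.mul_sum, Finset.sum_mul, mul_assoc]
      _ ≤ c * ∑ y ∈ t, c * ‖f y‖ ^ 2 := by
          gcongr with y
          exact hbound y
      _ ≤ c * (c * ‖f‖ ^ 2) := by
          rw [← Finset.mul_sum]
          gcongr
      _ = (c * ‖f‖) ^ 2 := by ring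
  simpa using key
end
end

section
/- Let X be a regular graph of degree k ≥ 3 and let Y be a spanning subgraph of X (same vertex set, edge set contained in that of X) which is regular of degree l for some l with 2 ≤ l ≤ k−1 and which contains no cycles (so Y is a disjoint union of l-regular trees). Then 2√(k−1)/k ≤ μ(X) ≤ (2√(l−1) + (k−l))/k. -/
noncomputable section

open Finset in
/-- Schur test for the adjacency operator of a symmetric, locally finite relation. -/
theorem exists_lp_neighbor_sum {V : Type*} (N : V → Finset V) (hN : ∀ x y, y ∈ N x → x ∈ N y)
    (w : V → ℝ) (hw : ∀ x, 0 < w x) {c : ℝ} (hc : 0 ≤ c)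
    (h : ∀ x, ∑ y ∈ N x, w y ≤ c * w x) (f : lp (fun _ : V => ℂ) 2) :
    ∃ g : lp (fun _ : V => ℂ) 2, (∀ x, g x = ∑ y ∈ N x, f y) ∧ ‖g‖ ≤ c * ‖f‖ := by
  classical
  have h2 : (0 : ℝ) < (2 : ENNReal).toReal := by norm_num
  have pointwise (x : V) : ‖∑ y ∈ N x, f y‖ ^ 2 ≤ c * ∑ y ∈ N x, w x * (‖f y‖ ^ 2 / w y) := by
    have hcs : (∑ y ∈ N x, ‖f y‖) ^ 2 ≤ (∑ y ∈ N x, w y) * ∑ y ∈ N x, ‖f y‖ ^ 2 / w y :=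
      sum_sq_le_sum_mul_sum_of_sq_le_mul _ (fun y _ => (hw y).le)
        (fun y _ => div_nonneg (sq_nonneg _) (hw y).le)
        (fun y _ => by have := (hw y).ne'; field_simp; rfl)
    have hnonneg : 0 ≤ ∑ y ∈ N x, ‖f y‖ ^ 2 / w y :=
      sum_nonneg fun y _ => div_nonneg (sq_nonneg _) (hw y).le
    calc ‖∑ y ∈ N x, f y‖ ^ 2 ≤ (∑ y ∈ N x, ‖f y‖) ^ 2 := by gcongr; exact norm_sum_le _ _
      _ ≤ (c * w x) * ∑ y ∈ N x, ‖f y‖ ^ 2 / w y :=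
          hcs.trans (mul_le_mul_of_nonneg_right (h x) hnonneg)
      _ = c * ∑ y ∈ N x, w x * (‖f y‖ ^ 2 / w y) := by rw [← mul_sum, mul_assoc]
  have bound (s : Finset V) :
      ∑ x ∈ s, ‖∑ y ∈ N x, f y‖ ^ (2 : ENNReal).toReal ≤ (c * ‖f‖) ^ (2 : ENNReal).toReal := by
    have hf := lp.sum_rpow_le_norm_rpow h2 f (s.biUnion N)
    simp only [ENNReal.toReal_ofNat, Real.rpow_ofNat] at hf ⊢
    calc ∑ x ∈ s, ‖∑ y ∈ N x, f y‖ ^ 2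
        ≤ ∑ x ∈ s, c * ∑ y ∈ N x, w x * (‖f y‖ ^ 2 / w y) := sum_le_sum fun x _ => pointwise x
      _ = c * ∑ y ∈ s.biUnion N, ∑ x ∈ s with y ∈ N x, w x * (‖f y‖ ^ 2 / w y) := by
          rw [← mul_sum]
          congr 1
          refine sum_comm' fun x y => ?_
          simp only [mem_biUnion, mem_filter]
          exact ⟨fun ⟨hx, hy⟩ => ⟨⟨hx, hy⟩, x, hx, hy⟩, fun ⟨hxy, _⟩ => hxy⟩
      _ ≤ c * ∑ y ∈ s.biUnion N, c * ‖f y‖ ^ 2 := by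
          refine mul_le_mul_of_nonneg_left (sum_le_sum fun y _ => ?_) hc
          rw [← sum_mul]
          have hle : ∑ x ∈ s with y ∈ N x, w x ≤ c * w y :=
            (sum_le_sum_of_subset_of_nonneg (fun x hx => hN x y (mem_filter.1 hx).2)
              fun x _ _ => (hw x).le).trans (h y)
          calc _ ≤ c * w y * (‖f y‖ ^ 2 / w y) :=
                mul_le_mul_of_nonneg_right hle (div_nonneg (sq_nonneg _) (hw y).le)
            _ = c * ‖f y‖ ^ 2 := by have := (hw y).ne'; field_simp
      _ ≤ (c * ‖f‖) ^ 2 := by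
          rw [← mul_sum, mul_pow, ← mul_assoc, ← sq]
          exact mul_le_mul_of_nonneg_left hf (sq_nonneg c)
  exact ⟨⟨fun x => ∑ y ∈ N x, f y, memℓp_gen' bound⟩, fun _ => rfl,
    lp.norm_le_of_forall_sum_le h2 (by positivity) bound⟩

namespace SimpleGraph

/-- In a forest, a vertex has at most one neighbour that is no further from the root. -/
theorem IsAcyclic.eq_of_adj_of_dist_le {V : Type*} {Y : SimpleGraph V} (hY : Y.IsAcyclic)
    {o x y z : V} (ho : Y.Reachable o x) (hxy : Y.Adj x y) (hxz : Y.Adj x z)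
    (hy : Y.dist o y ≤ Y.dist o x) (hz : Y.dist o z ≤ Y.dist o x) : y = z := by
  classical
  have key (v : V) (hv : Y.Adj x v) (hd : Y.dist o v ≤ Y.dist o x) :
      ∃ p : Y.Walk o v, (p.concat hv.symm).IsPath := by
    obtain ⟨p, hp, hlen⟩ := (ho.trans hv.reachable).exists_path_of_dist
    refine ⟨p, hp.concat (fun hx => ?_) hv.symm⟩
    have h1 := p.length_takeUntil_lt_length hx hv.ne
    have h2 := Y.dist_le (p.takeUntil x hx)
    omega
  obtain ⟨p, hp⟩ := key y hxy hy
  obtain ⟨p', hp'⟩ := key z hxz hz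
  have heq := congrArg Subtype.val ((hY.subsingleton_path o x).elim ⟨_, hp⟩ ⟨_, hp'⟩)
  exact (Walk.concat_inj heq).choose

theorem Connected.exists_adj_dist_le {V : Type*} {G : SimpleGraph V} (hG : G.Connected)
    {o x : V} {m : ℕ} (hx : G.dist o x = m + 1) : ∃ y, G.Adj x y ∧ G.dist o y ≤ m := by
  obtain ⟨p, hp⟩ := hG.exists_walk_length_eq_dist x o
  rw [dist_comm, hx] at hp
  cases p with
  | nil => simp at hp
  | cons h p =>
    refine ⟨_, h, ?_⟩
    rw [dist_comm]
    have := G.dist_le p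
    simp only [Walk.length_cons] at hp
    omega

theorem Adj.dist_le_succ {V : Type*} {G : SimpleGraph V} {x y : V} (h : G.Adj x y) (o : V) :
    G.dist o y ≤ G.dist o x + 1 := by
  have := h.diff_dist_adj (u := o)
  omega

theorem Connected.finite_setOf_dist_le {V : Type*} {G : SimpleGraph V}
    [∀ v, Fintype (G.neighborSet v)] (hG : G.Connected) (o : V) (n : ℕ) :
    {x | G.dist o x ≤ n}.Finite := by
  induction n with
  | zero =>
    refine (Set.finite_singleton o).subset fun x hx => ?_
    exact (hG.dist_eq_zero_iff.1 (Nat.le_zero.1 hx)).symm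
  | succ n ih =>
    refine (ih.union (ih.biUnion fun y _ => (G.neighborSet y).toFinite)).subset fun x hx => ?_
    rcases Nat.lt_or_ge n (G.dist o x) with hlt | hle
    · obtain ⟨y, hxy, hy⟩ := hG.exists_adj_dist_le (le_antisymm hx hlt)
      exact Or.inr (Set.mem_biUnion (show y ∈ {x | G.dist o x ≤ n} from hy) hxy.symm)
    · exact Or.inl hle

/-- A regular forest carries a positive function `w` with `A w ≤ 2√(l-1) w`. -/
theorem IsAcyclic.exists_pos_superharmonic {V : Type*} {Y : SimpleGraph V}
    [∀ v, Fintype (Y.neighborSet v)] (hY : Y.IsAcyclic) {l : ℕ} (hl : 2 ≤ l)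
    (hreg : Y.IsRegularOfDegree l) :
    ∃ w : V → ℝ, (∀ x, 0 < w x) ∧
      ∀ x, ∑ y ∈ Y.neighborFinset x, w y ≤ 2 * √((l : ℝ) - 1) * w x := by
  classical
  have hl' : (2 : ℝ) ≤ l := by exact_mod_cast hl
  set r := √((l : ℝ) - 1) with hr
  have hr2 : r ^ 2 = (l : ℝ) - 1 := Real.sq_sqrt (by linarith)
  have hr1 : 1 ≤ r := Real.one_le_sqrt.2 (by linarith)
  have hr0 : 0 < r := by linarith
  have hanti : Antitone fun n : ℕ => r⁻¹ ^ n :=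
    pow_right_anti₀ (by positivity) (inv_le_one_of_one_le₀ hr1)
  let root : V → V := fun x => (Y.connectedComponentMk x).out
  have hroot (x : V) : Y.Reachable (root x) x :=
    ConnectedComponent.exact (Quot.out_eq (Y.connectedComponentMk x))
  have root_adj {x y : V} (h : Y.Adj x y) : root y = root x := by
    simp only [root, ConnectedComponent.sound h.reachable]
  refine ⟨fun x => r⁻¹ ^ Y.dist (root x) x, fun x => by positivity, fun x => ?_⟩
  have hcongr : ∑ y ∈ Y.neighborFinset x, r⁻¹ ^ Y.dist (root y) y =
      ∑ y ∈ Y.neighborFinset x, r⁻¹ ^ Y.dist (root x) y :=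
    Finset.sum_congr rfl fun y hy => by rw [root_adj ((Y.mem_neighborFinset x y).1 hy)]
  have hcard : (Y.neighborFinset x).card = l := hreg x
  rw [hcongr]
  have hox := hroot x
  set o := root x
  set d := Y.dist o x with hd
  by_cases hex : ∃ y, Y.Adj x y ∧ Y.dist o y ≤ d
  · obtain ⟨z, hxz, hz⟩ := hex
    have hzmem : z ∈ Y.neighborFinset x := (Y.mem_neighborFinset x z).2 hxz
    obtain ⟨m, hm⟩ : ∃ m, d = m + 1 := by
      refine Nat.exists_eq_succ_of_ne_zero fun h0 => hxz.ne ?_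
      have hoz : Y.Reachable o z := hox.trans hxz.reachable
      rw [← hox.dist_eq_zero_iff.1 h0, ← hoz.dist_eq_zero_iff.1 (by omega)]
    have hz' : m ≤ Y.dist o z := by
      have := hxz.symm.dist_le_succ o
      omega
    rw [← Finset.add_sum_erase _ _ hzmem]
    have hrest : ∑ y ∈ (Y.neighborFinset x).erase z, r⁻¹ ^ Y.dist o y ≤
        ((l : ℝ) - 1) * r⁻¹ ^ (m + 2) := by
      refine (Finset.sum_le_card_nsmul _ _ (r⁻¹ ^ (m + 2)) fun y hy => hanti ?_).trans_eq ?_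
      · obtain ⟨hne, hy⟩ := Finset.mem_erase.1 hy
        have hxy := (Y.mem_neighborFinset x y).1 hy
        by_contra hlt
        have hlt' : Y.dist o y < m + 2 := not_le.1 hlt
        exact hne (hY.eq_of_adj_of_dist_le hox hxy hxz (by omega) hz)
      · rw [Finset.card_erase_of_mem hzmem, hcard, nsmul_eq_mul, Nat.cast_sub (by omega)]
        simp
    refine (add_le_add (hanti hz') hrest).trans_eq ?_
    change r⁻¹ ^ m + ((l : ℝ) - 1) * r⁻¹ ^ (m + 2) = 2 * r * r⁻¹ ^ d
    rw [hm, ← hr2, pow_add, pow_add]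
    field_simp
    ring
  · push Not at hex
    refine (Finset.sum_le_card_nsmul _ _ (r⁻¹ ^ (d + 1)) fun y hy =>
      hanti (hex y ((Y.mem_neighborFinset x y).1 hy))).trans ?_
    rw [hcard, nsmul_eq_mul, pow_succ, mul_comm (r⁻¹ ^ d), ← mul_assoc]
    refine mul_le_mul_of_nonneg_right ?_ (by positivity)
    rw [← div_eq_mul_inv, div_le_iff₀ hr0]
    nlinarith

end SimpleGraph

/-- Radial profile of a finitely supported function on a `(q+1)`-regular graph on which the
adjacency operator grows by a factor close to `2√q`. -/
theorem exists_radial_profile {q δ : ℝ} (hq : 2 ≤ q) (hδ : 0 < δ) (hδ1 : δ < 1) :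
    ∃ (φ : ℕ → ℝ) (N : ℕ), (∀ n, 0 ≤ φ n) ∧ 0 < φ 0 ∧ Antitone φ ∧ (∀ n, N ≤ n → φ n = 0) ∧
      √q * (2 - δ) * φ 0 ≤ (q + 1) * φ 1 ∧
      ∀ m, √q * (2 - δ) * φ (m + 1) ≤ φ m + q * φ (m + 2) := by
  set r := √q with hr
  have hr2 : r ^ 2 = q := Real.sq_sqrt (by linarith)
  have hr1 : 1 ≤ r := Real.one_le_sqrt.2 (by linarith)
  have hr0 : 0 < r := by linarith
  obtain ⟨N, hN⟩ := exists_nat_ge (12 / δ)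
  rw [div_le_iff₀ hδ] at hN
  have hN1 : 1 ≤ N := by
    rcases Nat.eq_zero_or_pos N with rfl | h
    · norm_num at hN
    · exact h
  set a := (q + 1) / (q - 1) with ha
  have haq : a * (q - 1) = q + 1 := div_mul_cancel₀ _ (by linarith)
  have ha1 : 1 ≤ a := by rw [ha, le_div_iff₀ (by linarith)]; linarith
  have har : a + 1 ≤ r * a := by
    have h1 : (a + 1) * (q - 1) = 2 * q := by linarith
    have h2 : (a + 1) * (q - 1) ≤ r * a * (q - 1) := by
      rw [h1, mul_assoc, haq, ← hr2]
      nlinarith [mul_nonneg hr0.le (sq_nonneg (r - 1))]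
    exact le_of_mul_le_mul_right h2 (by linarith)
  refine ⟨fun n => r⁻¹ ^ n * ((n + a) * ((N - n : ℕ) : ℝ) ^ 2), N, fun n => by positivity, ?_,
    antitone_nat_of_succ_le fun n => ?_, fun n hn => ?_, ?_, fun m => ?_⟩
  · have : (0 : ℝ) < N := by exact_mod_cast hN1
    simp only [Nat.sub_zero]
    positivity
  · have hsub : ((N - (n + 1) : ℕ) : ℝ) ≤ ((N - n : ℕ) : ℝ) := by
      exact_mod_cast Nat.sub_le_sub_left (Nat.le_succ n) N
    have hlin : (n + 1 : ℝ) + a ≤ r * (n + a) := by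
      nlinarith [mul_nonneg (Nat.cast_nonneg (α := ℝ) n) (sub_nonneg.2 hr1)]
    calc _ ≤ r⁻¹ ^ (n + 1) * (r * (n + a) * ((N - n : ℕ) : ℝ) ^ 2) := by
          push_cast
          gcongr
      _ = _ := by rw [pow_succ]; field_simp
  · simp [Nat.sub_eq_zero_of_le hn]
  · have hcast : ((N - 1 : ℕ) : ℝ) = N - 1 := by push_cast [Nat.cast_sub hN1]; ring
    have hN' : (1 : ℝ) ≤ N := by exact_mod_cast hN1
    have hpoly : (2 - δ) * (N : ℝ) ^ 2 ≤ 2 * (N - 1 : ℝ) ^ 2 := by nlinarith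
    have hqa : (q + 1) * (1 + a) = 2 * q * a := by linarith
    have hmain : q * a * ((2 - δ) * (N : ℝ) ^ 2) ≤ (q + 1) * (1 + a) * (N - 1 : ℝ) ^ 2 := by
      rw [hqa]
      have : 0 ≤ q * a := by positivity
      nlinarith
    simp only [pow_zero, Nat.cast_zero, Nat.sub_zero, pow_one, Nat.cast_one, hcast]
    calc _ = r⁻¹ * (q * a * ((2 - δ) * (N : ℝ) ^ 2)) := by rw [← hr2]; field_simp; ring
      _ ≤ r⁻¹ * ((q + 1) * (1 + a) * (N - 1 : ℝ) ^ 2) := by gcongr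
      _ = _ := by ring
  · rcases Nat.lt_or_ge (m + 1) N with hlt | hge
    · obtain ⟨j, rfl⟩ := Nat.exists_eq_add_of_lt hlt
      have e0 : m + 1 + j + 1 - m = j + 2 := by omega
      have e1 : m + 1 + j + 1 - (m + 1) = j + 1 := by omega
      have e2 : m + 1 + j + 1 - (m + 2) = j := by omega
      have hpoly : (2 - δ) * ((m + 1 + a) * (j + 1 : ℝ) ^ 2) ≤
          (m + a) * (j + 2 : ℝ) ^ 2 + (m + 2 + a) * (j : ℝ) ^ 2 := by
        push_cast at hN
        have hm : (0 : ℝ) ≤ m := m.cast_nonneg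
        have hj : (0 : ℝ) ≤ j := j.cast_nonneg
        suffices 4 * (j + 1 : ℝ) ≤ δ * ((m + 1 + a) * (j + 1 : ℝ) ^ 2) + 2 * (m + 1 + a) by
          linarith
        rcases le_total (2 * (j + 1 : ℝ)) (m + 1 + a) with h | h
        · have : 0 ≤ δ * ((m + 1 + a) * (j + 1 : ℝ) ^ 2) := by positivity
          linarith
        · have h4 : 4 ≤ δ * (j + 1 : ℝ) := by nlinarith
          have h5 : 4 * (j + 1 : ℝ) ≤ δ * (j + 1 : ℝ) * (j + 1) := by gcongr
          have h6 : δ * (j + 1 : ℝ) * (j + 1) ≤ (m + 1 + a) * (δ * (j + 1 : ℝ) * (j + 1)) :=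
            le_mul_of_one_le_left (by positivity) (by linarith)
          linarith
      simp only [e0, e1, e2]
      push_cast
      calc _ = r⁻¹ ^ m * ((2 - δ) * ((m + 1 + a) * (j + 1 : ℝ) ^ 2)) := by
            rw [pow_succ]; field_simp
        _ ≤ r⁻¹ ^ m * ((m + a) * (j + 2 : ℝ) ^ 2 + (m + 2 + a) * (j : ℝ) ^ 2) := by gcongr
        _ = _ := by rw [← hr2, pow_add _ m 2]; field_simp
    · have : 0 ≤ q := by linarith
      simp only [Nat.sub_eq_zero_of_le hge, Nat.cast_zero, ne_eq, OfNat.ofNat_ne_zero, not_false_eq_true, zero_pow, mul_zero]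
      positivity

theorem IsGraphMarkov.le_norm {V : Type*} {G : SimpleGraph V}
    [∀ v, Fintype (G.neighborSet v)] (hconn : G.Connected) {k : ℕ} (hk : 3 ≤ k)
    (hreg : G.IsRegularOfDegree k) {M : lp (fun _ : V => ℂ) 2 →L[ℂ] lp (fun _ : V => ℂ) 2}
    (hM : IsGraphMarkov G k M) : 2 * √((k : ℝ) - 1) / k ≤ ‖M‖ := by
  classical
  have hk' : (3 : ℝ) ≤ k := by exact_mod_cast hk
  have hk0 : (0 : ℝ) < k := by linarith
  set q : ℝ := (k : ℝ) - 1 with hqdef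
  have key (δ : ℝ) (hδ : 0 < δ) (hδ1 : δ < 1) : √q * (2 - δ) / k ≤ ‖M‖ := by
    obtain ⟨φ, N, hφ, hφ0, hanti, hzero, hroot, hstep⟩ :=
      exists_radial_profile (q := q) (by linarith) hδ hδ1
    obtain ⟨o⟩ := hconn.nonempty
    have hmem : Memℓp (fun x => (φ (G.dist o x) : ℂ)) 2 := by
      refine (memℓp_zero ((hconn.finite_setOf_dist_le o N).subset fun x hx => ?_)).of_exponent_ge
        zero_le
      by_contra hlt
      exact hx (by simp [hzero _ (not_le.1 hlt).le])
    let f : lp (fun _ : V => ℂ) 2 := ⟨_, hmem⟩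
    have hf (x : V) : f x = (φ (G.dist o x) : ℂ) := rfl
    have growth (x : V) : √q * (2 - δ) * φ (G.dist o x) ≤
        ∑ y ∈ G.neighborFinset x, φ (G.dist o y) := by
      have hcard : (G.neighborFinset x).card = k := hreg x
      have hlow (y : V) (hy : y ∈ G.neighborFinset x) : φ (G.dist o x + 1) ≤ φ (G.dist o y) :=
        hanti (((G.mem_neighborFinset x y).1 hy).dist_le_succ o)
      rcases hdx : G.dist o x with _ | m
      · have := Finset.card_nsmul_le_sum _ _ _ hlow
        rw [hcard, nsmul_eq_mul, hdx] at this
        refine hroot.trans (le_trans (le_of_eq ?_) this)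
        simp [hqdef]
      · obtain ⟨z, hxz, hz⟩ := hconn.exists_adj_dist_le hdx
        have hzmem : z ∈ G.neighborFinset x := (G.mem_neighborFinset x z).2 hxz
        have := Finset.card_nsmul_le_sum ((G.neighborFinset x).erase z) _ _
          fun y hy => hlow y (Finset.mem_of_mem_erase hy)
        rw [Finset.card_erase_of_mem hzmem, hcard, nsmul_eq_mul, Nat.cast_sub (by omega),
          Nat.cast_one, hdx] at this
        rw [← Finset.add_sum_erase _ _ hzmem]
        exact (hstep m).trans (add_le_add (hanti hz) this)
    have hcoef : 0 ≤ √q * (2 - δ) / k :=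
      div_nonneg (mul_nonneg (Real.sqrt_nonneg _) (by linarith)) hk0.le
    have hle : ‖((√q * (2 - δ) / k : ℝ) : ℂ) • f‖ ≤ ‖M f‖ := by
      refine lp.norm_mono (by norm_num) fun x => ?_
      have hMx : M f x = (((k : ℝ)⁻¹ * ∑ y ∈ G.neighborFinset x, φ (G.dist o y) : ℝ) : ℂ) := by
        rw [hM]
        simp [hf]
      rw [hMx, lp.coeFn_smul, Pi.smul_apply, hf, smul_eq_mul, ← Complex.ofReal_mul,
        Complex.norm_of_nonneg (mul_nonneg hcoef (hφ _)),
        Complex.norm_of_nonneg (mul_nonneg (by positivity) (Finset.sum_nonneg fun _ _ => hφ _)),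
        div_mul_eq_mul_div, div_eq_inv_mul]
      exact mul_le_mul_of_nonneg_left (growth x) (by positivity)
    have hfne : f ≠ 0 := fun h0 => by
      have := hf o
      rw [h0, SimpleGraph.dist_self, lp.coeFn_zero, Pi.zero_apply] at this
      exact hφ0.ne' (Complex.ofReal_eq_zero.1 this.symm)
    rw [norm_smul, Complex.norm_of_nonneg hcoef] at hle
    exact le_of_mul_le_mul_right (hle.trans (M.le_opNorm f)) (norm_pos_iff.2 hfne)
  have hlim : Filter.Tendsto (fun δ : ℝ => √q * (2 - δ) / k) (nhdsWithin 0 (Set.Ioi 0))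
      (nhds (2 * √q / k)) := by
    refine Filter.Tendsto.mono_left ?_ nhdsWithin_le_nhds
    have hcont : Continuous fun δ : ℝ => √q * (2 - δ) / k := by fun_prop
    convert hcont.tendsto 0 using 2
    ring
  refine le_of_tendsto hlim ?_
  filter_upwards [Ioo_mem_nhdsGT (zero_lt_one' ℝ)] with δ hδ
  exact key δ hδ.1 hδ.2

theorem IsGraphMarkov.norm_le {V : Type*} {G Y : SimpleGraph V}
    [∀ v, Fintype (G.neighborSet v)] [∀ v, Fintype (Y.neighborSet v)] {k l : ℕ}
    (hreg : G.IsRegularOfDegree k) (hYX : Y ≤ G) (hl : 2 ≤ l) (hlk : l < k)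
    (hYreg : Y.IsRegularOfDegree l) (hYacyclic : Y.IsAcyclic)
    {M : lp (fun _ : V => ℂ) 2 →L[ℂ] lp (fun _ : V => ℂ) 2} (hM : IsGraphMarkov G k M) :
    ‖M‖ ≤ (2 * √((l : ℝ) - 1) + ((k : ℝ) - l)) / k := by
  classical
  have hlk' : (l : ℝ) < k := by exact_mod_cast hlk
  have hk0 : (0 : ℝ) < k := l.cast_nonneg.trans_lt hlk'
  have hsub (x : V) : Y.neighborFinset x ⊆ G.neighborFinset x := fun y hy => by
    rw [SimpleGraph.mem_neighborFinset] at hy ⊢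
    exact hYX hy
  obtain ⟨w, hw, hwle⟩ := hYacyclic.exists_pos_superharmonic hl hYreg
  refine M.opNorm_le_bound
    (div_nonneg (add_nonneg (by positivity) (sub_nonneg.2 hlk'.le)) hk0.le) fun f => ?_
  obtain ⟨g, hg, hgn⟩ := exists_lp_neighbor_sum (fun x => Y.neighborFinset x)
    (fun x y h => by simpa [Y.adj_comm] using h) w hw (by positivity) hwle f
  obtain ⟨g', hg', hgn'⟩ := exists_lp_neighbor_sum
    (fun x => G.neighborFinset x \ Y.neighborFinset x)
    (fun x y h => by simpa [Y.adj_comm, G.adj_comm] using h) (fun _ => 1) (fun _ => one_pos)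
    (sub_nonneg.2 hlk'.le) (fun x => by
      have hcG : (G.neighborFinset x).card = k := hreg x
      have hcY : (Y.neighborFinset x).card = l := hYreg x
      rw [Finset.sum_const, Finset.card_sdiff_of_subset (hsub x), hcG, hcY, nsmul_eq_mul,
        Nat.cast_sub hlk.le]) f
  have hMf : M f = (k : ℂ)⁻¹ • (g + g') := by
    ext x
    rw [hM, lp.coeFn_smul, Pi.smul_apply, lp.coeFn_add, Pi.add_apply, hg, hg', smul_eq_mul,
      add_comm (∑ y ∈ Y.neighborFinset x, f y), Finset.sum_sdiff (hsub x)]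
  rw [hMf, norm_smul, norm_inv, Complex.norm_natCast, div_mul_eq_mul_div, div_eq_inv_mul,
    add_mul]
  gcongr
  exact (norm_add_le g g').trans (add_le_add hgn hgn')

/-- Proposition 3: let `X` be a connected `k`-regular graph, `k ≥ 3`, and let `Y` be a
spanning subgraph of `X` which is `l`-regular, `2 ≤ l ≤ k−1`, and contains no cycles
(a disjoint union of `l`-regular trees). Then
`2√(k−1)/k ≤ μ(X) ≤ (2√(l−1) + (k−l))/k`. -/
theorem spanning_forest_bound {V : Type*} (G : SimpleGraph V)
    [∀ v, Fintype (G.neighborSet v)]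
    (hconn : G.Connected) (k l : ℕ) (hk : 3 ≤ k) (hreg : G.IsRegularOfDegree k)
    (Y : SimpleGraph V) [∀ v, Fintype (Y.neighborSet v)] (hYX : Y ≤ G)
    (hl : 2 ≤ l) (hlk : l ≤ k - 1) (hYreg : Y.IsRegularOfDegree l)
    (hYacyclic : Y.IsAcyclic)
    (M : lp (fun _ : V => ℂ) 2 →L[ℂ] lp (fun _ : V => ℂ) 2)
    (hM : IsGraphMarkov G k M) :
    2 * Real.sqrt ((k : ℝ) - 1) / k ≤ ‖M‖ ∧
      ‖M‖ ≤ (2 * Real.sqrt ((l : ℝ) - 1) + ((k : ℝ) - l)) / k := by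
  exact ⟨hM.le_norm hconn hk hreg, hM.norm_le hreg hYX hl (by omega) hYreg hYacyclic⟩
end
end

section
/- Let X be a regular graph of degree k ≥ 3 and let Y be a spanning subgraph of X (same vertex set, edge set contained in that of X) which is regular of degree l for some l with 2 ≤ l ≤ k−1. Let M_Y be the Markov operator of Y on ℓ²(X⁰), (M_Y f)(x) = (1/l) · Σ_{y ∼_Y x} f(y), the sum being over the neighbours of x in Y. Then ‖M_X‖ ≤ (l/k)·‖M_Y‖ + (k−l)/k. -/
noncomputable section

/-- A symmetric finite-neighbourhood sum with at most `d` neighbours at every point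
has norm at most `d` on `ℓ²`. -/
theorem lp_two_norm_le_of_sum_neighbors {V : Type*} (N : V → Finset V)
    (hN : ∀ x y, y ∈ N x → x ∈ N y) (d : ℕ) (hd : ∀ x, (N x).card ≤ d)
    (f g : lp (fun _ : V => ℂ) 2) (hg : ∀ x, g x = ∑ y ∈ N x, f y) :
    ‖g‖ ≤ d * ‖f‖ := by
  classical
  refine lp.norm_le_of_forall_sum_le (by norm_num) (by positivity) fun s => ?_
  have hf := lp.sum_rpow_le_norm_rpow (p := 2) (by norm_num) f (s.biUnion N)
  simp only [ENNReal.toReal_ofNat, Real.rpow_two] at hf ⊢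
  have pointwise (x : V) : ‖g x‖ ^ 2 ≤ d * ∑ y ∈ N x, ‖f y‖ ^ 2 := by
    have hcard : ((N x).card : ℝ) ≤ d := by exact_mod_cast hd x
    calc ‖g x‖ ^ 2 ≤ (∑ y ∈ N x, ‖f y‖) ^ 2 := by
          rw [hg]
          gcongr
          exact norm_sum_le _ _
      _ ≤ (N x).card * ∑ y ∈ N x, ‖f y‖ ^ 2 := sq_sum_le_card_mul_sum_sq
      _ ≤ d * ∑ y ∈ N x, ‖f y‖ ^ 2 := by gcongr
  calc ∑ x ∈ s, ‖g x‖ ^ 2 ≤ ∑ x ∈ s, d * ∑ y ∈ N x, ‖f y‖ ^ 2 :=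
        Finset.sum_le_sum fun x _ => pointwise x
    _ = d * ∑ y ∈ s.biUnion N, ∑ x ∈ s with y ∈ N x, ‖f y‖ ^ 2 := by
        rw [← Finset.mul_sum]
        congr 1
        refine Finset.sum_comm' fun x y => ?_
        simp only [Finset.mem_filter, Finset.mem_biUnion]
        exact ⟨fun h => ⟨h, x, h⟩, fun h => h.1⟩
    _ ≤ d * ∑ y ∈ s.biUnion N, d * ‖f y‖ ^ 2 := by
        gcongr with y
        rw [Finset.sum_const, nsmul_eq_mul]
        gcongr
        refine (Finset.card_le_card fun x hx => ?_).trans (hd y)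
        exact hN x y (Finset.mem_filter.mp hx).2
    _ = d ^ 2 * ∑ y ∈ s.biUnion N, ‖f y‖ ^ 2 := by
        rw [← Finset.mul_sum]
        ring
    _ ≤ (d * ‖f‖) ^ 2 := by
        rw [mul_pow]
        gcongr

/-- For a `k`-regular graph `X` (`k ≥ 3`) with a spanning `l`-regular subgraph `Y`
(`2 ≤ l ≤ k−1`), one has `‖M_X‖ ≤ (l/k)‖M_Y‖ + (k−l)/k`. -/
theorem markov_subgraph_bound {V : Type*} (G : SimpleGraph V)
    [∀ v, Fintype (G.neighborSet v)]
    (hconn : G.Connected) (k l : ℕ) (hk : 3 ≤ k) (hreg : G.IsRegularOfDegree k)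
    (Y : SimpleGraph V) [∀ v, Fintype (Y.neighborSet v)] (hYX : Y ≤ G)
    (hl : 2 ≤ l) (hlk : l ≤ k - 1) (hYreg : Y.IsRegularOfDegree l)
    (MX MY : lp (fun _ : V => ℂ) 2 →L[ℂ] lp (fun _ : V => ℂ) 2)
    (hMX : IsGraphMarkov G k MX) (hMY : IsGraphMarkov Y l MY) :
    ‖MX‖ ≤ ((l : ℝ) / k) * ‖MY‖ + ((k : ℝ) - l) / k := by
  classical
  have hk0 : (k : ℂ) ≠ 0 := by
    rw [Nat.cast_ne_zero]
    omega
  have hl0 : (l : ℂ) ≠ 0 := by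
    rw [Nat.cast_ne_zero]
    omega
  have hk_pos : (0 : ℝ) < k := by
    rw [Nat.cast_pos]
    omega
  have hlk' : l ≤ k := by omega
  have hkl : (0 : ℝ) ≤ (k : ℝ) - l := sub_nonneg.mpr (by exact_mod_cast hlk')
  have hsub (x : V) : Y.neighborFinset x ⊆ G.neighborFinset x := fun y hy => by
    rw [SimpleGraph.mem_neighborFinset] at hy ⊢
    exact hYX hy
  refine ContinuousLinearMap.opNorm_le_bound _ (by positivity) fun f => ?_
  have hdiff : ‖(k : ℂ) • MX f - (l : ℂ) • MY f‖ ≤ ((k : ℝ) - l) * ‖f‖ := by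
    rw [← Nat.cast_sub hlk']
    refine lp_two_norm_le_of_sum_neighbors
      (fun x => G.neighborFinset x \ Y.neighborFinset x) ?_ (k - l) ?_ f _ ?_
    · intro x y
      simp [SimpleGraph.adj_comm]
    · intro x
      rw [Finset.card_sdiff_of_subset (hsub x), SimpleGraph.card_neighborFinset_eq_degree,
        SimpleGraph.card_neighborFinset_eq_degree, hreg x, hYreg x]
    · intro x
      simp only [lp.coeFn_sub, lp.coeFn_smul, Pi.sub_apply, Pi.smul_apply, smul_eq_mul,
        hMX f x, hMY f x, mul_inv_cancel_left₀ hk0, mul_inv_cancel_left₀ hl0]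
      rw [Finset.sum_sdiff_eq_sub (hsub x)]
  have hsum : k * ‖MX f‖ ≤ l * (‖MY‖ * ‖f‖) + ((k : ℝ) - l) * ‖f‖ := by
    calc k * ‖MX f‖ = ‖(l : ℂ) • MY f + ((k : ℂ) • MX f - (l : ℂ) • MY f)‖ := by
          rw [add_sub_cancel, norm_smul, Complex.norm_natCast]
      _ ≤ l * ‖MY f‖ + ((k : ℝ) - l) * ‖f‖ := by
          refine (norm_add_le _ _).trans (add_le_add ?_ hdiff)
          rw [norm_smul, Complex.norm_natCast]
      _ ≤ l * (‖MY‖ * ‖f‖) + ((k : ℝ) - l) * ‖f‖ := by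
          gcongr
          exact MY.le_opNorm f
  calc ‖MX f‖ ≤ (l * (‖MY‖ * ‖f‖) + ((k : ℝ) - l) * ‖f‖) / k :=
        (le_div_iff₀' hk_pos).mpr hsum
    _ = ((l : ℝ) / k * ‖MY‖ + ((k : ℝ) - l) / k) * ‖f‖ := by ring
end
end
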